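/- arXiv:1204.0329 — 10 statements merged into one kernel-verified Lean document; each statement's English description precedes it below -/
import Mathlib

section
/- Let n ≥ 2, let y, z ∈ ℝ^n with y ≠ z, and let G = ℝ^n \ {y, z}. Then for every x ∈ G and every r > 0 the Apollonian metric ball B_α(x,r) = {w ∈ G : α_G(x,w) < r} is not a convex set. -/
/-- The Apollonian distance in the twice punctured space `ℝⁿ \ {y, z}`:
the maximum over boundary points `a, b ∈ {y, z}` of
`log (|a−w||x−b| / (|a−x||w−b|))`. -/
noncomputable def apoTwice {n : ℕ} (y z x w : EuclideanSpace ℝ (Fin n)) : ℝ :=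
  max
    (max (Real.log (dist y w * dist x y / (dist y x * dist w y)))
         (Real.log (dist y w * dist x z / (dist y x * dist w z))))
    (max (Real.log (dist z w * dist x y / (dist z x * dist w y)))
         (Real.log (dist z w * dist x z / (dist z x * dist w z))))

theorem apoTwice_swap {n : ℕ} (y z x w : EuclideanSpace ℝ (Fin n)) :
    apoTwice y z x w = apoTwice z y x w := by
  unfold apoTwice
  rw [max_comm, max_comm (Real.log (dist z w * dist x y / (dist z x * dist w y))),
    max_comm (Real.log (dist y w * dist x y / (dist y x * dist w y)))]

theorem apoTwice_lt_of_mul_lt {n : ℕ} {y z x w : EuclideanSpace ℝ (Fin n)} {r : ℝ} (hr : 0 < r)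
    (hxy : x ≠ y) (hxz : x ≠ z) (hwy : w ≠ y) (hwz : w ≠ z)
    (h₁ : dist w y * dist x z < Real.exp r * (dist x y * dist w z))
    (h₂ : dist w z * dist x y < Real.exp r * (dist x z * dist w y)) :
    apoTwice y z x w < r := by
  have := dist_pos.2 hxy
  have := dist_pos.2 hxz
  have := dist_pos.2 hwy
  have := dist_pos.2 hwz
  unfold apoTwice
  rw [dist_comm y w, dist_comm z w, dist_comm y x, dist_comm z x,
    mul_comm (dist w y) (dist x y), mul_comm (dist w z) (dist x z),
    div_self (by positivity), div_self (by positivity), Real.log_one]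
  refine max_lt (max_lt hr ?_) (max_lt ?_ hr)
  · rwa [Real.log_lt_iff_lt_exp (by positivity), div_lt_iff₀ (by positivity)]
  · rwa [Real.log_lt_iff_lt_exp (by positivity), div_lt_iff₀ (by positivity)]

theorem exists_norm_eq_one_inner_eq_zero {n : ℕ} (hn : 2 ≤ n) (v : EuclideanSpace ℝ (Fin n)) :
    ∃ u : EuclideanSpace ℝ (Fin n), ‖u‖ = 1 ∧ inner ℝ v u = 0 := by
  have hne : (Submodule.span ℝ {v})ᗮ ≠ ⊥ := by
    intro h
    have h₁ := (Submodule.span ℝ {v}).finrank_add_finrank_orthogonal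
    rw [h, finrank_bot, finrank_euclideanSpace_fin] at h₁
    have h₂ := finrank_span_le_card (R := ℝ) ({v} : Set (EuclideanSpace ℝ (Fin n)))
    simp at h₂
    omega
  obtain ⟨u, hu, hu0⟩ := Submodule.exists_mem_ne_zero_of_ne_bot hne
  refine ⟨‖u‖⁻¹ • u, norm_smul_inv_norm (𝕜 := ℝ) hu0, ?_⟩
  rw [inner_smul_right, Submodule.mem_orthogonal_singleton_iff_inner_right.1 hu, mul_zero]

/-- The sphere `|w - y| = C |w - z|` with `0 < C < 1` has a chord with midpoint `y`. -/
theorem exists_dist_eq_mul_dist {n : ℕ} (hn : 2 ≤ n) {y z : EuclideanSpace ℝ (Fin n)}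
    (hyz : y ≠ z) {C : ℝ} (hC₀ : 0 < C) (hC₁ : C < 1) :
    ∃ v : EuclideanSpace ℝ (Fin n), v ≠ 0 ∧
      dist (y + v) y = C * dist (y + v) z ∧ dist (y - v) y = C * dist (y - v) z := by
  obtain ⟨u, hu, huv⟩ := exists_norm_eq_one_inner_eq_zero hn (y - z)
  have hd : 0 < ‖y - z‖ := norm_pos_iff.2 (sub_ne_zero.2 hyz)
  have hC : 0 < 1 - C ^ 2 := by nlinarith
  set t : ℝ := C * ‖y - z‖ / √(1 - C ^ 2) with ht
  have ht₀ : 0 < t := by positivity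
  have ht₂ : t ^ 2 = C ^ 2 * (‖y - z‖ ^ 2 + t ^ 2) := by
    rw [ht, div_pow, Real.sq_sqrt hC.le]
    field_simp
    ring
  have hnorm : ‖t • u‖ = t := by rw [norm_smul, hu, mul_one, Real.norm_of_nonneg ht₀.le]
  have hinner : inner ℝ (y - z) (t • u) = 0 := by rw [inner_smul_right, huv, mul_zero]
  refine ⟨t • u, norm_pos_iff.1 (hnorm.symm ▸ ht₀), ?_, ?_⟩
  · rw [dist_eq_norm, dist_eq_norm, add_sub_cancel_left, hnorm, add_sub_right_comm]
    refine (sq_eq_sq₀ ht₀.le (by positivity)).1 ?_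
    rw [mul_pow, norm_add_sq_real, hinner, hnorm, ht₂]
    linear_combination C ^ 2 * ht₂
  · rw [dist_eq_norm, dist_eq_norm, sub_sub_cancel_left, norm_neg, hnorm, sub_right_comm]
    refine (sq_eq_sq₀ ht₀.le (by positivity)).1 ?_
    rw [mul_pow, norm_sub_sq_real, hinner, hnorm, ht₂]
    linear_combination C ^ 2 * ht₂

theorem not_convex_apoTwice_ball_of_dist_lt {n : ℕ} (hn : 2 ≤ n)
    {y z x : EuclideanSpace ℝ (Fin n)} (hyz : y ≠ z) (hxy : x ≠ y) (hxz : x ≠ z)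
    {r : ℝ} (hr : 0 < r) (h : dist x y < Real.exp r * dist x z) :
    ¬ Convex ℝ {w : EuclideanSpace ℝ (Fin n) |
      (w ≠ y ∧ w ≠ z) ∧ apoTwice y z x w < r} := by
  intro hconv
  have hy := dist_pos.2 hxy
  have hz := dist_pos.2 hxz
  have hE : 1 < Real.exp r := Real.one_lt_exp_iff.2 hr
  obtain ⟨C, hlow, hup⟩ : ∃ C, dist x y / (Real.exp r * dist x z) < C ∧
      C < min 1 (Real.exp r * dist x y / dist x z) := by
    refine exists_between (lt_min ?_ ?_)
    · rwa [div_lt_one (by positivity)]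
    · rw [div_lt_div_iff₀ (by positivity) hz]
      have : 0 < dist x y * dist x z := by positivity
      nlinarith [mul_lt_mul'' hE hE zero_le_one zero_le_one]
  obtain ⟨hC₁, hup⟩ := lt_min_iff.1 hup
  have hC₀ : 0 < C := lt_trans (by positivity) hlow
  rw [div_lt_iff₀ (by positivity)] at hlow
  rw [lt_div_iff₀ hz] at hup
  obtain ⟨v, hv, hadd, hsub⟩ := exists_dist_eq_mul_dist hn hyz hC₀ hC₁
  have hmem : ∀ w, w ≠ y → dist w y = C * dist w z →
      (w ≠ y ∧ w ≠ z) ∧ apoTwice y z x w < r := by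
    intro w hwy hw
    have hwz : 0 < dist w z := pos_of_mul_pos_right (hw ▸ dist_pos.2 hwy) hC₀.le
    refine ⟨⟨hwy, dist_pos.1 hwz⟩,
      apoTwice_lt_of_mul_lt hr hxy hxz hwy (dist_pos.1 hwz) ?_ ?_⟩
    · rw [hw]
      linarith [mul_lt_mul_of_pos_right hup hwz]
    · rw [hw]
      linarith [mul_lt_mul_of_pos_right hlow hwz]
  have hmid := hconv.midpoint_mem (hmem (y + v) (by simpa using hv) hadd)
    (hmem (y - v) (by simpa using hv) hsub)
  rw [midpoint_add_sub] at hmid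
  exact hmid.1.1 rfl

/-- In the twice punctured space `G = ℝⁿ \ {y, z}` (with `y ≠ z`, `n ≥ 2`),
no Apollonian metric ball `B_α(x, r)` is convex. -/
theorem apollonian_ball_twice_punctured_not_convex
    (n : ℕ) (hn : 2 ≤ n) (y z : EuclideanSpace ℝ (Fin n)) (hyz : y ≠ z)
    (x : EuclideanSpace ℝ (Fin n)) (hx : x ≠ y ∧ x ≠ z) (r : ℝ) (hr : 0 < r) :
    ¬ Convex ℝ {w : EuclideanSpace ℝ (Fin n) |
      (w ≠ y ∧ w ≠ z) ∧ apoTwice y z x w < r} := by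
  have hE : 1 < Real.exp r := Real.one_lt_exp_iff.2 hr
  have hy := dist_pos.2 hx.1
  have hz := dist_pos.2 hx.2
  rcases le_total (dist x y) (dist x z) with h | h
  · exact not_convex_apoTwice_ball_of_dist_lt hn hyz hx.1 hx.2 hr (by nlinarith)
  · simp only [apoTwice_swap y z, and_comm (a := _ ≠ y) (b := _ ≠ z)]
    exact not_convex_apoTwice_ball_of_dist_lt hn hyz.symm hx.2 hx.1 hr (by nlinarith)
end

section
/- Let n ≥ 2, G = 𝔹^n \ {0}, x ∈ G, and r_0 = log(1 + 1/(1−|x|)). Then for every r with 0 < r ≤ r_0 the ball B_δ(x,r) is convex. -/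
/-- Seittenranta's distance in the punctured unit ball `𝔹ⁿ \ {0}`, whose boundary is
`S^{n−1}(0,1) ∪ {0}`:
`δ_G(x,w) = sup_{a,b ∈ ∂G} log (1 + |a−b||x−w| / (|a−x||w−b|))`. -/
noncomputable def seitPuncturedBall {n : ℕ} (x w : EuclideanSpace ℝ (Fin n)) : ℝ :=
  sSup {t : ℝ |
    ∃ a ∈ Metric.sphere (0 : EuclideanSpace ℝ (Fin n)) 1 ∪ {0},
    ∃ b ∈ Metric.sphere (0 : EuclideanSpace ℝ (Fin n)) 1 ∪ {0},
    t = Real.log (1 + dist a b * dist x w / (dist a x * dist w b))}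

lemma norm_sub_pos_of_lt_one {E : Type*} [NormedAddCommGroup E] {x c : E}
    (hx : ‖x‖ < 1) (hc : ‖c‖ = 1) : 0 < ‖c - x‖ := by
  have := norm_sub_norm_le c x
  linarith

lemma one_sub_norm_sq_pos {E : Type*} [NormedAddCommGroup E] {x : E}
    (hx : ‖x‖ < 1) : 0 < 1 - ‖x‖ ^ 2 := by
  nlinarith [norm_nonneg x]

/-- The quantity `‖x - w‖² + (1 - ‖x‖²)(1 - ‖w‖²)`, which is
`1 - 2⟪x, w⟫ + ‖x‖²‖w‖²` in an inner product space. -/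
noncomputable def ahlforsSq {E : Type*} [NormedAddCommGroup E] (x w : E) : ℝ :=
  ‖x - w‖ ^ 2 + (1 - ‖x‖ ^ 2) * (1 - ‖w‖ ^ 2)

lemma ahlforsSq_pos {E : Type*} [NormedAddCommGroup E] {x w : E}
    (hx : ‖x‖ < 1) (hw : ‖w‖ < 1) : 0 < ahlforsSq x w := by
  have := mul_pos (one_sub_norm_sq_pos hx) (one_sub_norm_sq_pos hw)
  unfold ahlforsSq
  positivity

lemma norm_sub_le_sqrt_ahlforsSq {E : Type*} [NormedAddCommGroup E] {x w : E}
    (hx : ‖x‖ < 1) (hw : ‖w‖ < 1) :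
    ‖x - w‖ ≤ √(ahlforsSq x w) := by
  have := mul_pos (one_sub_norm_sq_pos hx) (one_sub_norm_sq_pos hw)
  apply Real.le_sqrt_of_sq_le
  unfold ahlforsSq
  linarith

section ChordInvolution

variable {E : Type*} [NormedAddCommGroup E] [InnerProductSpace ℝ E]

/-- For `c` on the unit sphere and `x` in the open unit ball, the second intersection of the
line through `c` and `x` with the unit sphere. -/
noncomputable def chordInv (x c : E) : E :=
  x - ((1 - ‖x‖ ^ 2) / ‖c - x‖ ^ 2) • (c - x)

lemma chordInv_sub (x c : E) :
    chordInv x c - x = (-((1 - ‖x‖ ^ 2) / ‖c - x‖ ^ 2)) • (c - x) := by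
  rw [chordInv, neg_smul]
  abel

lemma norm_chordInv_sub {x c : E} (hx : ‖x‖ < 1) (hc : ‖c‖ = 1) :
    ‖chordInv x c - x‖ = (1 - ‖x‖ ^ 2) / ‖c - x‖ := by
  have hp := norm_sub_pos_of_lt_one hx hc
  have hm := one_sub_norm_sq_pos hx
  rw [chordInv_sub, norm_smul, norm_neg, Real.norm_of_nonneg (by positivity)]
  field_simp

lemma norm_chordInv {x c : E} (hx : ‖x‖ < 1) (hc : ‖c‖ = 1) : ‖chordInv x c‖ = 1 := by
  have hp := norm_sub_pos_of_lt_one hx hc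
  have hsq : ‖c‖ ^ 2 = ‖x‖ ^ 2 + 2 * inner ℝ x (c - x) + ‖c - x‖ ^ 2 := by
    rw [← norm_add_sq_real, add_sub_cancel]
  have h : ‖chordInv x c‖ ^ 2 = 1 := by
    rw [chordInv, norm_sub_sq_real, inner_smul_right, norm_smul, mul_pow, Real.norm_eq_abs, sq_abs]
    have hi : inner ℝ x (c - x) = (1 - ‖x‖ ^ 2 - ‖c - x‖ ^ 2) / 2 := by
      rw [hc] at hsq
      linarith
    rw [hi]
    field_simp
    ring
  exact (sq_eq_sq₀ (norm_nonneg _) zero_le_one).1 (by rw [h, one_pow])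

lemma chordInv_chordInv {x c : E} (hx : ‖x‖ < 1) (hc : ‖c‖ = 1) :
    chordInv x (chordInv x c) = c := by
  have hp := norm_sub_pos_of_lt_one hx hc
  have hm := one_sub_norm_sq_pos hx
  rw [chordInv, norm_chordInv_sub hx hc, chordInv_sub, smul_smul]
  have : (1 - ‖x‖ ^ 2) / ((1 - ‖x‖ ^ 2) / ‖c - x‖) ^ 2 *
      -((1 - ‖x‖ ^ 2) / ‖c - x‖ ^ 2) = -1 := by
    field_simp
  rw [this]
  simp

lemma norm_chordInv_sub_chordInv {x c d : E} (hx : ‖x‖ < 1) (hc : ‖c‖ = 1) (hd : ‖d‖ = 1) :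
    ‖chordInv x c - chordInv x d‖ =
      (1 - ‖x‖ ^ 2) * ‖c - d‖ / (‖c - x‖ * ‖d - x‖) := by
  have hp := norm_sub_pos_of_lt_one hx hc
  have hq := norm_sub_pos_of_lt_one hx hd
  have hm := one_sub_norm_sq_pos hx
  refine (sq_eq_sq₀ (norm_nonneg _) (by positivity)).1 ?_
  have h1 : chordInv x c - chordInv x d = (chordInv x c - x) - (chordInv x d - x) := by abel
  have h2 : ‖c - d‖ ^ 2 = ‖c - x‖ ^ 2 - 2 * inner ℝ (c - x) (d - x) + ‖d - x‖ ^ 2 := by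
    rw [← norm_sub_sq_real, sub_sub_sub_cancel_right]
  rw [h1, norm_sub_sq_real, norm_chordInv_sub hx hc, norm_chordInv_sub hx hd, chordInv_sub,
    chordInv_sub, inner_smul_left, inner_smul_right, div_pow _ (‖c - x‖ * ‖d - x‖), mul_pow _ ‖c - d‖, h2]
  simp only [conj_trivial]
  field_simp
  ring

/-- The direction in which the distance ratio `‖w - b‖ / ‖b - x‖` grows, seen after
`chordInv x`. -/
noncomputable def chordDir (x w : E) : E :=
  (1 - ‖x‖ ^ 2) • (w - x) - (‖x - w‖ ^ 2) • x

lemma norm_sq_expand (x w : E) :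
    ‖w‖ ^ 2 = ‖x‖ ^ 2 + 2 * inner ℝ x (w - x) + ‖x - w‖ ^ 2 := by
  rw [norm_sub_rev x w, ← norm_add_sq_real, add_sub_cancel]

lemma norm_chordDir {x w : E} (hx : ‖x‖ < 1) (hw : ‖w‖ < 1) :
    ‖chordDir x w‖ = ‖x - w‖ * √(ahlforsSq x w) := by
  refine (sq_eq_sq₀ (norm_nonneg _) (by positivity)).1 ?_
  rw [mul_pow, Real.sq_sqrt (ahlforsSq_pos hx hw).le, chordDir, norm_sub_sq_real,
    inner_smul_left, inner_smul_right, norm_smul, norm_smul, mul_pow, mul_pow, Real.norm_eq_abs,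
    Real.norm_eq_abs, sq_abs, sq_abs, real_inner_comm, ahlforsSq, norm_sq_expand x w,
    norm_sub_rev w x]
  simp only [conj_trivial]
  ring

lemma sq_norm_sub_chordInv {x w c : E} (hx : ‖x‖ < 1) (hc : ‖c‖ = 1) :
    ((1 - ‖x‖ ^ 2) * ‖w - chordInv x c‖) ^ 2 = ‖chordInv x c - x‖ ^ 2 *
      (‖x - w‖ ^ 2 + ahlforsSq x w + 2 * inner ℝ c (chordDir x w)) := by
  have hp := norm_sub_pos_of_lt_one hx hc
  have h1 : w - chordInv x c = (w - x) - (chordInv x c - x) := by abel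
  have hcx : ‖c - x‖ ^ 2 = 1 - 2 * inner ℝ c x + ‖x‖ ^ 2 := by
    rw [norm_sub_sq_real, hc, one_pow]
  have hi : inner ℝ (w - x) (c - x) = inner ℝ c (w - x) - inner ℝ x (w - x) := by
    rw [real_inner_comm, inner_sub_left]
  have hv : inner ℝ c (chordDir x w) =
      (1 - ‖x‖ ^ 2) * inner ℝ c (w - x) - ‖x - w‖ ^ 2 * inner ℝ c x := by
    rw [chordDir, inner_sub_right, inner_smul_right, inner_smul_right]
  rw [h1, mul_pow, norm_sub_sq_real, norm_chordInv_sub hx hc, chordInv_sub, inner_smul_right, hi,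
    hv, ahlforsSq, norm_sq_expand x w, norm_sub_rev w x]
  have hcx' : inner ℝ c x = (1 + ‖x‖ ^ 2 - ‖c - x‖ ^ 2) / 2 := by linarith
  rw [hcx']
  field_simp
  ring

/-- The condition defining closed balls of Seittenranta's metric of the unit ball, in the
variable `R = e^r - 1`, is a quadratic inequality. -/
lemma forall_sphere_cross_ratio_le_iff {x w : E} (hx : ‖x‖ < 1) (hw : ‖w‖ < 1) {R : ℝ}
    (hR : 0 ≤ R) :
    (∀ a b : E, ‖a‖ = 1 → ‖b‖ = 1 → ‖a - b‖ * ‖x - w‖ ≤ R * (‖a - x‖ * ‖w - b‖)) ↔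
      (4 + 4 * R) * ‖x - w‖ ^ 2 + R ^ 2 * (1 - ‖x‖ ^ 2) * ‖w‖ ^ 2 ≤ R ^ 2 * (1 - ‖x‖ ^ 2) := by
  have hm := one_sub_norm_sq_pos hx
  have hA := ahlforsSq_pos hx hw
  have hS : 0 < √(ahlforsSq x w) := Real.sqrt_pos.2 hA
  have hSS := Real.sq_sqrt hA.le
  have hDS := norm_sub_le_sqrt_ahlforsSq hx hw
  have hN := norm_chordDir hx hw
  have hAdef : ahlforsSq x w = ‖x - w‖ ^ 2 + (1 - ‖x‖ ^ 2) * (1 - ‖w‖ ^ 2) := rfl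
  have hD := norm_nonneg (x - w)
  have key : (2 + R) * ‖x - w‖ ≤ R * √(ahlforsSq x w) ↔
      (4 + 4 * R) * ‖x - w‖ ^ 2 + R ^ 2 * (1 - ‖x‖ ^ 2) * ‖w‖ ^ 2 ≤ R ^ 2 * (1 - ‖x‖ ^ 2) := by
    rw [← sq_le_sq₀ (by positivity) (by positivity), mul_pow, mul_pow, hSS, hAdef]
    constructor <;> intro h <;> linarith
  rw [← key]
  set D := ‖x - w‖ with hDdef
  set S := √(ahlforsSq x w) with hSdef
  constructor
  · intro h
    rcases hD.eq_or_lt with h0 | hDpos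
    · rw [← h0, mul_zero]
      positivity
    have hv : 0 < ‖chordDir x w‖ := by
      rw [hN]
      positivity
    set c : E := (-‖chordDir x w‖⁻¹) • chordDir x w with hc
    have hc1 : ‖c‖ = 1 := by
      rw [hc, norm_smul, norm_neg, norm_inv, norm_norm, inv_mul_cancel₀ hv.ne']
    have hc1' : ‖-c‖ = 1 := by rw [norm_neg, hc1]
    have hic : inner ℝ c (chordDir x w) = -(D * S) := by
      rw [hc, inner_smul_left, real_inner_self_eq_norm_sq, ← hN]
      simp only [conj_trivial]
      field_simp
    have hb := sq_norm_sub_chordInv (w := w) hx hc1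
    rw [hic, ← hDdef, ← hSS] at hb
    have hb' : (1 - ‖x‖ ^ 2) * ‖w - chordInv x c‖ = ‖chordInv x c - x‖ * (S - D) := by
      refine (sq_eq_sq₀ (by positivity) (mul_nonneg (norm_nonneg _) (by linarith))).1 ?_
      rw [hb]
      ring
    have hab := h _ _ (norm_chordInv hx hc1') (norm_chordInv hx hc1)
    have hp := norm_sub_pos_of_lt_one hx hc1
    have hq := norm_sub_pos_of_lt_one hx hc1'
    have h2 : ‖-c - c‖ = 2 := by
      rw [show -c - c = (-2 : ℝ) • c by rw [neg_smul, two_smul]; abel, norm_smul, hc1]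
      norm_num
    rw [norm_chordInv_sub hx hc1] at hb'
    have hb'' : ‖w - chordInv x c‖ = (S - D) / ‖c - x‖ := by
      rw [eq_div_iff hp.ne']
      apply mul_left_cancel₀ hm.ne'
      rw [← mul_assoc, hb']
      field_simp
    rw [norm_chordInv_sub_chordInv hx hc1' hc1, h2, norm_chordInv_sub hx hc1', hb''] at hab
    have e1 : (1 - ‖x‖ ^ 2) * 2 / (‖-c - x‖ * ‖c - x‖) * D =
        (1 - ‖x‖ ^ 2) / (‖-c - x‖ * ‖c - x‖) * (2 * D) := by ring
    have e2 : R * ((1 - ‖x‖ ^ 2) / ‖-c - x‖ * ((S - D) / ‖c - x‖)) =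
        (1 - ‖x‖ ^ 2) / (‖-c - x‖ * ‖c - x‖) * (R * (S - D)) := by
      field_simp
    rw [e1, e2] at hab
    have := le_of_mul_le_mul_left hab (by positivity)
    linarith
  · intro h a b ha hb
    obtain ⟨c, hc1, rfl⟩ : ∃ c : E, ‖c‖ = 1 ∧ chordInv x c = b :=
      ⟨chordInv x b, norm_chordInv hx hb, chordInv_chordInv hx hb⟩
    obtain ⟨d, hd1, rfl⟩ : ∃ d : E, ‖d‖ = 1 ∧ chordInv x d = a :=
      ⟨chordInv x a, norm_chordInv hx ha, chordInv_chordInv hx ha⟩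
    have hp := norm_sub_pos_of_lt_one hx hc1
    have hq := norm_sub_pos_of_lt_one hx hd1
    have hic : -(D * S) ≤ inner ℝ c (chordDir x w) := by
      have := neg_le_of_abs_le (abs_real_inner_le_norm c (chordDir x w))
      rwa [hc1, one_mul, hN] at this
    have hbs := sq_norm_sub_chordInv (w := w) hx hc1
    have hb' : ‖chordInv x c - x‖ * (S - D) ≤ (1 - ‖x‖ ^ 2) * ‖w - chordInv x c‖ := by
      refine (sq_le_sq₀ (mul_nonneg (norm_nonneg _) (by linarith)) (by positivity)).1 ?_
      rw [hbs, mul_pow]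
      refine mul_le_mul_of_nonneg_left ?_ (sq_nonneg _)
      nlinarith
    have hb'' : (S - D) / ‖c - x‖ ≤ ‖w - chordInv x c‖ := by
      refine le_of_mul_le_mul_left (le_of_eq_of_le ?_ hb') hm
      rw [norm_chordInv_sub hx hc1]
      field_simp
    have h2 : ‖d - c‖ ≤ 2 := by
      have := norm_sub_le d c
      linarith
    rw [norm_chordInv_sub_chordInv hx hd1 hc1, norm_chordInv_sub hx hd1]
    calc (1 - ‖x‖ ^ 2) * ‖d - c‖ / (‖d - x‖ * ‖c - x‖) * D
        ≤ (1 - ‖x‖ ^ 2) * 2 / (‖d - x‖ * ‖c - x‖) * D := by gcongr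
      _ = (1 - ‖x‖ ^ 2) / (‖d - x‖ * ‖c - x‖) * (2 * D) := by ring
      _ ≤ (1 - ‖x‖ ^ 2) / (‖d - x‖ * ‖c - x‖) * (R * (S - D)) := by
          refine mul_le_mul_of_nonneg_left ?_ (by positivity)
          linarith
      _ = R * ((1 - ‖x‖ ^ 2) / ‖d - x‖ * ((S - D) / ‖c - x‖)) := by field_simp
      _ ≤ R * ((1 - ‖x‖ ^ 2) / ‖d - x‖ * ‖w - chordInv x c‖) := by gcongr

lemma exists_norm_eq_one_norm_sub_eq {w : E} (hw0 : w ≠ 0) (hw : ‖w‖ < 1) :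
    ∃ b : E, ‖b‖ = 1 ∧ ‖w - b‖ = 1 - ‖w‖ := by
  have hpos := norm_pos_iff.2 hw0
  refine ⟨‖w‖⁻¹ • w, ?_, ?_⟩
  · rw [norm_smul, norm_inv, norm_norm, inv_mul_cancel₀ hpos.ne']
  · have h1 : 0 ≤ ‖w‖⁻¹ - 1 := sub_nonneg.2 ((one_le_inv₀ hpos).2 hw.le)
    rw [norm_sub_rev, show ‖w‖⁻¹ • w - w = (‖w‖⁻¹ - 1) • w by rw [sub_smul, one_smul], norm_smul,
      Real.norm_of_nonneg h1]
    field_simp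

/-- Closed-ball condition for Seittenranta's metric of the punctured unit ball, in the variable
`R = e^r - 1`, written as three explicit inequalities. -/
lemma forall_boundary_cross_ratio_le_iff {x w : E} (hx0 : x ≠ 0) (hx : ‖x‖ < 1) (hw0 : w ≠ 0)
    (hw : ‖w‖ < 1) {R : ℝ} (hR : 0 ≤ R) :
    (∀ a ∈ Metric.sphere (0 : E) 1 ∪ {0}, ∀ b ∈ Metric.sphere (0 : E) 1 ∪ {0},
      ‖a - b‖ * ‖x - w‖ ≤ R * (‖a - x‖ * ‖w - b‖)) ↔
    ‖x - w‖ + R * ‖x‖ * ‖w‖ ≤ R * ‖x‖ ∧ ‖x - w‖ ≤ R * (1 - ‖x‖) * ‖w‖ ∧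
      (4 + 4 * R) * ‖x - w‖ ^ 2 + R ^ 2 * (1 - ‖x‖ ^ 2) * ‖w‖ ^ 2 ≤ R ^ 2 * (1 - ‖x‖ ^ 2) := by
  rw [← forall_sphere_cross_ratio_le_iff hx hw hR]
  constructor
  · intro h
    refine ⟨?_, ?_, fun a b ha hb => h a (by simp [ha]) b (by simp [hb])⟩
    · obtain ⟨b, hb, hwb⟩ := exists_norm_eq_one_norm_sub_eq hw0 hw
      have := h 0 (by simp) b (by simp [hb])
      rw [zero_sub, zero_sub, norm_neg, norm_neg, hb, hwb] at this
      linarith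
    · obtain ⟨a, ha, hxa⟩ := exists_norm_eq_one_norm_sub_eq hx0 hx
      have := h a (by simp [ha]) 0 (by simp)
      rw [sub_zero, sub_zero, norm_sub_rev a x, ha, hxa] at this
      linarith
  · rintro ⟨h1, h2, h3⟩ a ha b hb
    simp only [Set.mem_union, mem_sphere_zero_iff_norm, Set.mem_singleton_iff] at ha hb
    rcases ha with ha | rfl <;> rcases hb with hb | rfl
    · exact h3 a b ha hb
    · have hax : 1 - ‖x‖ ≤ ‖a - x‖ := ha ▸ norm_sub_norm_le a x
      rw [sub_zero, sub_zero, ha, one_mul, ← mul_assoc]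
      exact h2.trans (by gcongr)
    · have hbw : 1 - ‖w‖ ≤ ‖w - b‖ := by
        rw [norm_sub_rev]
        exact hb ▸ norm_sub_norm_le b w
      rw [zero_sub, zero_sub, norm_neg, norm_neg, hb, one_mul, ← mul_assoc]
      calc ‖x - w‖ ≤ R * ‖x‖ * (1 - ‖w‖) := by linarith
        _ ≤ R * ‖x‖ * ‖w - b‖ := by gcongr
    · rw [sub_self, norm_zero, zero_mul]
      positivity

lemma norm_combo_le {s t : ℝ} (hs : 0 ≤ s) (ht : 0 ≤ t) (u v : E) :
    ‖s • u + t • v‖ ≤ s * ‖u‖ + t * ‖v‖ := by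
  refine (norm_add_le _ _).trans_eq ?_
  rw [norm_smul, norm_smul, Real.norm_of_nonneg hs, Real.norm_of_nonneg ht]

lemma norm_combo_sq_le {s t : ℝ} (hs : 0 ≤ s) (ht : 0 ≤ t) (hst : s + t = 1) (u v : E) :
    ‖s • u + t • v‖ ^ 2 ≤ s * ‖u‖ ^ 2 + t * ‖v‖ ^ 2 := by
  have h := norm_combo_le hs ht u v
  have h2 : ‖s • u + t • v‖ ^ 2 ≤ (s * ‖u‖ + t * ‖v‖) ^ 2 := by gcongr
  obtain rfl : t = 1 - s := by linarith
  nlinarith [mul_nonneg (mul_nonneg hs ht) (sq_nonneg (‖u‖ - ‖v‖))]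

lemma convex_setOf_norm_sub_le_mul_norm (x : E) {c : ℝ} (hc0 : 0 ≤ c) (hc : c ≤ 1) :
    Convex ℝ {w : E | ‖x - w‖ ≤ c * ‖w‖} := by
  have key : ∀ w : E, ‖x - w‖ ≤ c * ‖w‖ ↔
      ‖x‖ ^ 2 - 2 * inner ℝ x w + (1 - c ^ 2) * ‖w‖ ^ 2 ≤ 0 := by
    intro w
    rw [← sq_le_sq₀ (norm_nonneg _) (by positivity), norm_sub_sq_real]
    constructor <;> intro h <;> linarith
  intro u hu v hv s t hs ht hst
  rw [Set.mem_ofPred_eq, key] at hu hv ⊢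
  have h1 := mul_le_mul_of_nonneg_left (norm_combo_sq_le hs ht hst u v)
    (show 0 ≤ 1 - c ^ 2 by nlinarith)
  rw [inner_add_right, inner_smul_right, inner_smul_right]
  obtain rfl : t = 1 - s := by linarith
  have := mul_nonpos_of_nonneg_of_nonpos hs hu
  have := mul_nonpos_of_nonneg_of_nonpos ht hv
  linarith

end ChordInvolution

lemma bddAbove_seitPuncturedBall {n : ℕ} {x w : EuclideanSpace ℝ (Fin n)} (hx0 : x ≠ 0)
    (hx : ‖x‖ < 1) (hw0 : w ≠ 0) (hw : ‖w‖ < 1) :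
    BddAbove {t : ℝ |
      ∃ a ∈ Metric.sphere (0 : EuclideanSpace ℝ (Fin n)) 1 ∪ {0},
      ∃ b ∈ Metric.sphere (0 : EuclideanSpace ℝ (Fin n)) 1 ∪ {0},
      t = Real.log (1 + dist a b * dist x w / (dist a x * dist w b))} := by
  have low : ∀ y : EuclideanSpace ℝ (Fin n), ∀ a ∈ Metric.sphere 0 1 ∪ {0},
      min ‖y‖ (1 - ‖y‖) ≤ dist a y := by
    intro y a ha
    simp only [Set.mem_union, mem_sphere_zero_iff_norm, Set.mem_singleton_iff] at ha
    rw [dist_eq_norm]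
    rcases ha with ha | rfl
    · exact (min_le_right _ _).trans (ha ▸ norm_sub_norm_le a y)
    · simp
  have up : ∀ a ∈ Metric.sphere (0 : EuclideanSpace ℝ (Fin n)) 1 ∪ {0}, ‖a‖ ≤ 1 := by
    intro a ha
    simp only [Set.mem_union, mem_sphere_zero_iff_norm, Set.mem_singleton_iff] at ha
    rcases ha with ha | rfl
    · exact ha.le
    · simp
  have hmx : 0 < min ‖x‖ (1 - ‖x‖) := lt_min (norm_pos_iff.2 hx0) (by linarith)
  have hmw : 0 < min ‖w‖ (1 - ‖w‖) := lt_min (norm_pos_iff.2 hw0) (by linarith)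
  refine ⟨Real.log (1 + 2 * dist x w / (min ‖x‖ (1 - ‖x‖) * min ‖w‖ (1 - ‖w‖))), ?_⟩
  rintro t ⟨a, ha, b, hb, rfl⟩
  have h1 := low x a ha
  have h2 := low w b hb
  rw [dist_comm b w] at h2
  have h3 : dist a b ≤ 2 := by
    rw [dist_eq_norm]
    linarith [norm_sub_le a b, up a ha, up b hb]
  apply Real.log_le_log (by positivity)
  gcongr

lemma seitPuncturedBall_nonneg {n : ℕ} {x w : EuclideanSpace ℝ (Fin n)} :
    0 ≤ seitPuncturedBall x w := by
  apply Real.sSup_nonneg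
  rintro t ⟨a, -, b, -, rfl⟩
  exact Real.log_nonneg (le_add_of_nonneg_right (by positivity))

lemma seitPuncturedBall_le_iff {n : ℕ} {x w : EuclideanSpace ℝ (Fin n)} (hx0 : x ≠ 0)
    (hx : ‖x‖ < 1) (hw0 : w ≠ 0) (hw : ‖w‖ < 1) {r : ℝ} :
    seitPuncturedBall x w ≤ r ↔
    ∀ a ∈ Metric.sphere (0 : EuclideanSpace ℝ (Fin n)) 1 ∪ {0},
      ∀ b ∈ Metric.sphere (0 : EuclideanSpace ℝ (Fin n)) 1 ∪ {0},
      ‖a - b‖ * ‖x - w‖ ≤ (Real.exp r - 1) * (‖a - x‖ * ‖w - b‖) := by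
  have hne : ∀ y : EuclideanSpace ℝ (Fin n), y ≠ 0 → ‖y‖ < 1 →
      ∀ a ∈ Metric.sphere (0 : EuclideanSpace ℝ (Fin n)) 1 ∪ {0}, 0 < ‖a - y‖ := by
    intro y hy0 hy a ha
    rw [norm_pos_iff, sub_ne_zero]
    rintro rfl
    simp only [Set.mem_union, mem_sphere_zero_iff_norm, Set.mem_singleton_iff] at ha
    exact ha.elim hy.ne hy0
  rw [seitPuncturedBall, csSup_le_iff (bddAbove_seitPuncturedBall hx0 hx hw0 hw)
    ⟨_, 0, by simp, 0, by simp, rfl⟩]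
  have key : ∀ a ∈ Metric.sphere (0 : EuclideanSpace ℝ (Fin n)) 1 ∪ {0},
      ∀ b ∈ Metric.sphere (0 : EuclideanSpace ℝ (Fin n)) 1 ∪ {0},
      (Real.log (1 + dist a b * dist x w / (dist a x * dist w b)) ≤ r ↔
        ‖a - b‖ * ‖x - w‖ ≤ (Real.exp r - 1) * (‖a - x‖ * ‖w - b‖)) := by
    intro a ha b hb
    have h1 := hne x hx0 hx a ha
    have h2 := hne w hw0 hw b hb
    rw [norm_sub_rev] at h2
    rw [Real.log_le_iff_le_exp (by positivity), dist_eq_norm, dist_eq_norm, dist_eq_norm,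
      dist_eq_norm, ← le_sub_iff_add_le', div_le_iff₀ (by positivity)]
  constructor
  · intro h a ha b hb
    exact (key a ha b hb).1 (h _ ⟨a, ha, b, hb, rfl⟩)
  · rintro h t ⟨a, ha, b, hb, rfl⟩
    exact (key a ha b hb).2 (h a ha b hb)

/-- In `G = 𝔹ⁿ \ {0}` (`n ≥ 2`), with `x ∈ G` and `r₀ = log (1 + 1/(1−|x|))`,
the ball `B_δ(x,r)` of Seittenranta's metric is convex for all `0 < r ≤ r₀`. -/
theorem seittenranta_ball_punctured_ball_convex
    (n : ℕ) (hn : 2 ≤ n) (x : EuclideanSpace ℝ (Fin n))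
    (hx : x ∈ Metric.ball (0 : EuclideanSpace ℝ (Fin n)) 1 \ {0})
    (r : ℝ) (hr : 0 < r) (hr0 : r ≤ Real.log (1 + 1 / (1 - ‖x‖))) :
    Convex ℝ {w : EuclideanSpace ℝ (Fin n) |
      w ∈ Metric.ball (0 : EuclideanSpace ℝ (Fin n)) 1 \ {0} ∧
      seitPuncturedBall x w < r} := by
  obtain ⟨hx1, hx0⟩ := hx
  rw [mem_ball_zero_iff] at hx1
  rw [Set.mem_singleton_iff] at hx0
  rintro u ⟨⟨hu1, hu0⟩, hur⟩ v ⟨⟨hv1, hv0⟩, hvr⟩ s t hs ht hst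
  have hw1 := convex_ball (0 : EuclideanSpace ℝ (Fin n)) 1 hu1 hv1 hs ht hst
  refine ⟨⟨hw1, ?_⟩, ?_⟩
  all_goals
    rw [mem_ball_zero_iff] at hu1 hv1 hw1
    rw [Set.mem_singleton_iff] at hu0 hv0
    obtain ⟨q, hq, hqr⟩ : ∃ q, max (seitPuncturedBall x u) (seitPuncturedBall x v) = q ∧ q < r :=
      ⟨_, rfl, max_lt hur hvr⟩
    have huq : seitPuncturedBall x u ≤ q := hq ▸ le_max_left _ _
    have hvq : seitPuncturedBall x v ≤ q := hq ▸ le_max_right _ _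
    have hq0 : 0 ≤ q := seitPuncturedBall_nonneg.trans huq
    have hR : 0 ≤ Real.exp q - 1 := sub_nonneg.2 (Real.one_le_exp hq0)
    have hx1' : 0 < 1 - ‖x‖ := by linarith
    have hRc : (Real.exp q - 1) * (1 - ‖x‖) < 1 := by
      have := (Real.lt_log_iff_exp_lt (by positivity)).1 (hqr.trans_le hr0)
      rw [← lt_div_iff₀ hx1']
      linarith
    rw [seitPuncturedBall_le_iff hx0 hx1 hu0 hu1,
      forall_boundary_cross_ratio_le_iff hx0 hx1 hu0 hu1 hR] at huq
    rw [seitPuncturedBall_le_iff hx0 hx1 hv0 hv1,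
      forall_boundary_cross_ratio_le_iff hx0 hx1 hv0 hv1 hR] at hvq
    obtain ⟨hua, hub, huc⟩ := huq
    obtain ⟨hva, hvb, hvc⟩ := hvq
    have hwb : ‖x - (s • u + t • v)‖ ≤ (Real.exp q - 1) * (1 - ‖x‖) * ‖s • u + t • v‖ :=
      convex_setOf_norm_sub_le_mul_norm x (by positivity) hRc.le hub hvb hs ht hst
    have hw0 : s • u + t • v ≠ 0 := by
      intro h0
      rw [h0, sub_zero, norm_zero, mul_zero, norm_le_zero_iff] at hwb
      exact hx0 hwb
  · exact hw0
  · refine lt_of_le_of_lt ?_ hqr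
    rw [seitPuncturedBall_le_iff hx0 hx1 hw0 hw1,
      forall_boundary_cross_ratio_le_iff hx0 hx1 hw0 hw1 hR]
    have hm := one_sub_norm_sq_pos hx1
    have hxw : x - (s • u + t • v) = s • (x - u) + t • (x - v) := by
      obtain rfl : t = 1 - s := by linarith
      module
    have a1 := norm_combo_le hs ht (x - u) (x - v)
    have a2 := norm_combo_sq_le hs ht hst (x - u) (x - v)
    have b1 := norm_combo_le hs ht u v
    have b2 := norm_combo_sq_le hs ht hst u v
    rw [← hxw] at a1 a2
    set R := Real.exp q - 1
    refine ⟨?_, hwb, ?_⟩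
    · calc ‖x - (s • u + t • v)‖ + R * ‖x‖ * ‖s • u + t • v‖
          ≤ (s * ‖x - u‖ + t * ‖x - v‖) + R * ‖x‖ * (s * ‖u‖ + t * ‖v‖) := by gcongr
        _ = s * (‖x - u‖ + R * ‖x‖ * ‖u‖) + t * (‖x - v‖ + R * ‖x‖ * ‖v‖) := by ring
        _ ≤ s * (R * ‖x‖) + t * (R * ‖x‖) := by gcongr
        _ = R * ‖x‖ := by rw [← add_mul, hst, one_mul]
    · set M := R ^ 2 * (1 - ‖x‖ ^ 2)
      calc (4 + 4 * R) * ‖x - (s • u + t • v)‖ ^ 2 + M * ‖s • u + t • v‖ ^ 2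
          ≤ (4 + 4 * R) * (s * ‖x - u‖ ^ 2 + t * ‖x - v‖ ^ 2) +
              M * (s * ‖u‖ ^ 2 + t * ‖v‖ ^ 2) := by gcongr
        _ = s * ((4 + 4 * R) * ‖x - u‖ ^ 2 + M * ‖u‖ ^ 2) +
              t * ((4 + 4 * R) * ‖x - v‖ ^ 2 + M * ‖v‖ ^ 2) := by ring
        _ ≤ s * M + t * M := by gcongr
        _ = M := by rw [← add_mul, hst, one_mul]
end

section
/- Let n ≥ 2, G = 𝔹^n \ {0}, x ∈ G, and r_0 = log(1 + 1/(1−|x|)). Then for every r > r_0 the ball B_δ(x,r) is not convex. -/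
theorem exists_ne_zero_inner_eq_zero_of_two_le {n : ℕ} (hn : 2 ≤ n)
    (x : EuclideanSpace ℝ (Fin n)) :
    ∃ e : EuclideanSpace ℝ (Fin n), e ≠ 0 ∧ inner ℝ x e = 0 := by
  have hne : (Submodule.span ℝ {x})ᗮ ≠ ⊥ := by
    intro h
    have h1 := Submodule.finrank_add_finrank_orthogonal (Submodule.span ℝ {x})
    have h2 := finrank_span_le_card (R := ℝ) ({x} : Set (EuclideanSpace ℝ (Fin n)))
    rw [Set.toFinset_singleton, Finset.card_singleton] at h2
    rw [h, finrank_bot, finrank_euclideanSpace_fin] at h1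
    omega
  obtain ⟨e, he, he0⟩ := Submodule.exists_mem_ne_zero_of_ne_bot hne
  exact ⟨e, he0, Submodule.mem_orthogonal_singleton_iff_inner_right.mp he⟩

/-- For `w` close enough to the segment `[0, x/2]`, the pair `a = x/|x|`, `b = 0` is extremal
in the definition of Seittenranta's distance. -/
theorem dist_mul_le_dist_mul_dist_of_mem_boundary {n : ℕ} {x w a b : EuclideanSpace ℝ (Fin n)}
    (hx1 : ‖x‖ < 1) (hwx : ‖w‖ ≤ ‖x‖) (hw : ‖w‖ ≤ 1 / 2)
    (hd : (2 - ‖x‖ - ‖w‖ + dist x w) * ‖w‖ ≤ 1 - ‖w‖)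
    (ha : a ∈ Metric.sphere (0 : EuclideanSpace ℝ (Fin n)) 1 ∪ {0})
    (hb : b ∈ Metric.sphere (0 : EuclideanSpace ℝ (Fin n)) 1 ∪ {0}) :
    dist a b * ((1 - ‖x‖) * ‖w‖) ≤ dist a x * dist w b := by
  have hw0 := norm_nonneg w
  have hx0 := norm_nonneg x
  have hsub : ∀ c y : EuclideanSpace ℝ (Fin n), ‖c‖ = 1 → 1 - ‖y‖ ≤ dist c y := by
    intro c y hc
    rw [dist_eq_norm, ← hc]
    exact norm_sub_norm_le c y
  simp only [Set.mem_union, mem_sphere_zero_iff_norm, Set.mem_singleton_iff] at ha hb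
  rcases ha with ha | rfl <;> rcases hb with hb | rfl
  · have hA := hsub a x ha
    have hB := hsub b w hb
    rw [dist_comm b w] at hB
    have htri : dist a b ≤ dist a x + dist x w + dist w b := dist_triangle4 a x w b
    set A := dist a x
    set B := dist w b
    set d := dist x w
    have hc : 0 ≤ (1 - ‖x‖) * ‖w‖ := mul_nonneg (by linarith) hw0
    refine (mul_le_mul_of_nonneg_right htri hc).trans ?_
    have hcB : (1 - ‖x‖) * ‖w‖ ≤ B := by nlinarith [mul_nonneg hx0 hw0]
    have h1 : 0 ≤ (A - (1 - ‖x‖)) * (B - (1 - ‖x‖) * ‖w‖) :=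
      mul_nonneg (by linarith) (by linarith)
    have h2 : 0 ≤ (B - (1 - ‖w‖)) * ((1 - ‖x‖) * (1 - ‖w‖)) :=
      mul_nonneg (by linarith) (mul_nonneg (by linarith) (by linarith))
    have h3 := mul_le_mul_of_nonneg_left hd (by linarith : 0 ≤ 1 - ‖x‖)
    nlinarith
  · rw [dist_zero_right, dist_zero_right, ha, one_mul]
    exact mul_le_mul_of_nonneg_right (hsub a x ha) hw0
  · have hB := hsub b w hb
    rw [dist_comm b w] at hB
    rw [dist_zero_left, dist_zero_left, hb, one_mul]
    nlinarith [mul_le_mul_of_nonneg_left hB hx0]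
  · rw [dist_self, zero_mul]
    positivity

theorem log_le_log_of_mem_boundary {n : ℕ} {x w a b : EuclideanSpace ℝ (Fin n)}
    (hx1 : ‖x‖ < 1) (hx0 : x ≠ 0) (hw0 : w ≠ 0) (hwx : ‖w‖ ≤ ‖x‖) (hw : ‖w‖ ≤ 1 / 2)
    (hd : (2 - ‖x‖ - ‖w‖ + dist x w) * ‖w‖ ≤ 1 - ‖w‖)
    (ha : a ∈ Metric.sphere (0 : EuclideanSpace ℝ (Fin n)) 1 ∪ {0})
    (hb : b ∈ Metric.sphere (0 : EuclideanSpace ℝ (Fin n)) 1 ∪ {0}) :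
    Real.log (1 + dist a b * dist x w / (dist a x * dist w b)) ≤
      Real.log (1 + dist x w / ((1 - ‖x‖) * ‖w‖)) := by
  have key := dist_mul_le_dist_mul_dist_of_mem_boundary hx1 hwx hw hd ha hb
  have hne : ∀ c y : EuclideanSpace ℝ (Fin n),
      c ∈ Metric.sphere (0 : EuclideanSpace ℝ (Fin n)) 1 ∪ {0} → y ≠ 0 → ‖y‖ < 1 → c ≠ y := by
    rintro c y hc hy hy1 rfl
    simp only [Set.mem_union, mem_sphere_zero_iff_norm, Set.mem_singleton_iff] at hc
    rcases hc with hc | hc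
    · linarith
    · exact hy hc
  have hax : 0 < dist a x := dist_pos.mpr (hne a x ha hx0 hx1)
  have hwb : 0 < dist w b := dist_pos.mpr (hne b w hb hw0 (by linarith)).symm
  have hc : 0 < (1 - ‖x‖) * ‖w‖ := mul_pos (by linarith) (norm_pos_iff.mpr hw0)
  refine Real.log_le_log (by positivity) ?_
  rw [add_le_add_iff_left, div_le_div_iff₀ (mul_pos hax hwb) hc]
  nlinarith [mul_le_mul_of_nonneg_right key (dist_nonneg (x := x) (y := w))]

theorem seitPuncturedBall_eq {n : ℕ} {x w : EuclideanSpace ℝ (Fin n)}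
    (hx1 : ‖x‖ < 1) (hx0 : x ≠ 0) (hw0 : w ≠ 0) (hwx : ‖w‖ ≤ ‖x‖) (hw : ‖w‖ ≤ 1 / 2)
    (hd : (2 - ‖x‖ - ‖w‖ + dist x w) * ‖w‖ ≤ 1 - ‖w‖) :
    seitPuncturedBall x w = Real.log (1 + dist x w / ((1 - ‖x‖) * ‖w‖)) := by
  have hxpos : 0 < ‖x‖ := norm_pos_iff.mpr hx0
  refine IsGreatest.csSup_eq ⟨⟨‖x‖⁻¹ • x, Or.inl ?_, 0, Or.inr rfl, ?_⟩, ?_⟩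
  · simp [norm_smul, hxpos.ne']
  · have h1 : ‖‖x‖⁻¹ • x‖ = 1 := by simp [norm_smul, hxpos.ne']
    have h2 : dist (‖x‖⁻¹ • x) x = 1 - ‖x‖ := by
      have h3 : ‖x‖⁻¹ • x - x = (‖x‖⁻¹ - 1) • x := by rw [sub_smul, one_smul]
      have h4 : 0 ≤ ‖x‖⁻¹ - 1 := by
        rw [sub_nonneg]
        exact (one_le_inv₀ hxpos).mpr hx1.le
      rw [dist_eq_norm, h3, norm_smul, Real.norm_of_nonneg h4]
      field_simp
    rw [h2, dist_zero_right, dist_zero_right, h1, one_mul]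
  · rintro t ⟨a, ha, b, hb, rfl⟩
    exact log_le_log_of_mem_boundary hx1 hx0 hw0 hwx hw hd ha hb

/-- In `G = 𝔹ⁿ \ {0}` (`n ≥ 2`), with `x ∈ G` and `r₀ = log (1 + 1/(1−|x|))`,
the ball `B_δ(x,r)` of Seittenranta's metric is not convex for any `r > r₀`. -/
theorem seittenranta_ball_punctured_ball_not_convex
    (n : ℕ) (hn : 2 ≤ n) (x : EuclideanSpace ℝ (Fin n))
    (hx : x ∈ Metric.ball (0 : EuclideanSpace ℝ (Fin n)) 1 \ {0})
    (r : ℝ) (hr0 : Real.log (1 + 1 / (1 - ‖x‖)) < r) :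
    ¬ Convex ℝ {w : EuclideanSpace ℝ (Fin n) |
      w ∈ Metric.ball (0 : EuclideanSpace ℝ (Fin n)) 1 \ {0} ∧
      seitPuncturedBall x w < r} := by
  obtain ⟨hxball, hx0⟩ := hx
  rw [mem_ball_zero_iff] at hxball
  have hx0 : x ≠ 0 := hx0
  have hs : 0 < ‖x‖ := norm_pos_iff.mpr hx0
  have h1s : 0 < 1 - ‖x‖ := by linarith
  set k : ℝ := (Real.exp r - 1) * (1 - ‖x‖) with hk
  have hk1 : 1 < k := by
    have h := (Real.log_lt_iff_lt_exp (by positivity)).mp hr0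
    have h' : 1 / (1 - ‖x‖) < Real.exp r - 1 := by linarith
    exact (div_lt_iff₀ h1s).mp h'
  have hlt_iff : ∀ w : EuclideanSpace ℝ (Fin n), w ≠ 0 →
      (Real.log (1 + dist x w / ((1 - ‖x‖) * ‖w‖)) < r ↔ dist x w < k * ‖w‖) := by
    intro w hw
    have hwpos : 0 < ‖w‖ := norm_pos_iff.mpr hw
    rw [Real.log_lt_iff_lt_exp (by positivity), ← lt_sub_iff_add_lt',
      div_lt_iff₀ (mul_pos h1s hwpos), hk, mul_assoc]
  set p : EuclideanSpace ℝ (Fin n) := (1 / (k + 1)) • x with hp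
  have hq : 0 < 1 / (k + 1) := by positivity
  have hp0 : p ≠ 0 := smul_ne_zero hq.ne' hx0
  have hpn : ‖p‖ = 1 / (k + 1) * ‖x‖ := by rw [hp, norm_smul, Real.norm_of_nonneg hq.le]
  have hq2 : 1 / (k + 1) < 1 / 2 := one_div_lt_one_div_of_lt (by norm_num) (by linarith)
  have hxp : x - p = (1 - 1 / (k + 1)) • x := by rw [sub_smul, one_smul]
  have hpd : dist x p = ‖x‖ - ‖p‖ := by
    rw [dist_eq_norm, hxp, norm_smul, Real.norm_of_nonneg (by linarith), hpn]
    ring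
  have hpk : dist x p = k * ‖p‖ := by
    rw [hpd, hpn]
    field_simp
    ring
  let U : Set (EuclideanSpace ℝ (Fin n)) := {w | w ≠ 0 ∧ ‖w‖ < ‖x‖ ∧ ‖w‖ < 1 / 2 ∧
    (2 - ‖x‖ - ‖w‖ + dist x w) * ‖w‖ < 1 - ‖w‖}
  have hU : IsOpen U := by
    have h1 : IsOpen {w : EuclideanSpace ℝ (Fin n) | ‖w‖ < ‖x‖} :=
      isOpen_lt (by fun_prop) (by fun_prop)
    have h2 : IsOpen {w : EuclideanSpace ℝ (Fin n) | ‖w‖ < 1 / 2} :=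
      isOpen_lt (by fun_prop) (by fun_prop)
    have h3 : IsOpen {w : EuclideanSpace ℝ (Fin n) |
        (2 - ‖x‖ - ‖w‖ + dist x w) * ‖w‖ < 1 - ‖w‖} :=
      isOpen_lt (by fun_prop) (by fun_prop)
    exact isOpen_ne.inter (h1.inter (h2.inter h3))
  have hpU : p ∈ U := by
    have hp2 : ‖p‖ < 1 / 2 := by rw [hpn]; nlinarith
    refine ⟨hp0, by rw [hpn]; nlinarith, hp2, ?_⟩
    rw [hpd]
    nlinarith
  have hball : ∀ w ∈ U, (w ∈ {w : EuclideanSpace ℝ (Fin n) |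
      w ∈ Metric.ball (0 : EuclideanSpace ℝ (Fin n)) 1 \ {0} ∧ seitPuncturedBall x w < r} ↔
      dist x w < k * ‖w‖) := by
    rintro w ⟨hw0, hwx, hw, hd⟩
    rw [← hlt_iff w hw0, ← seitPuncturedBall_eq hxball hx0 hw0 hwx.le hw.le hd.le]
    exact ⟨fun h => h.2, fun h => ⟨⟨mem_ball_zero_iff.mpr (by linarith), hw0⟩, h⟩⟩
  obtain ⟨e, he0, hxe⟩ := exists_ne_zero_inner_eq_zero_of_two_le hn x
  have hcont : Continuous fun t : ℝ => p + t • e := by fun_prop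
  obtain ⟨ε, hε, hεU⟩ := Metric.isOpen_iff.mp (hU.preimage hcont) 0 (by simpa using hpU)
  have hmem : ∀ t : ℝ, t ≠ 0 → |t| < ε → p + t • e ∈ {w : EuclideanSpace ℝ (Fin n) |
      w ∈ Metric.ball (0 : EuclideanSpace ℝ (Fin n)) 1 \ {0} ∧ seitPuncturedBall x w < r} := by
    intro t ht htε
    refine (hball _ (hεU (by simpa using htε))).mpr ?_
    have hte : 0 < ‖t • e‖ := norm_pos_iff.mpr (smul_ne_zero ht he0)
    have hw : ‖p + t • e‖ ^ 2 = ‖p‖ ^ 2 + ‖t • e‖ ^ 2 := by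
      rw [norm_add_sq_real, hp, inner_smul_left, inner_smul_right, hxe]
      simp
    have hd : dist x (p + t • e) ^ 2 = dist x p ^ 2 + ‖t • e‖ ^ 2 := by
      rw [dist_eq_norm, dist_eq_norm, ← sub_sub, norm_sub_sq_real, hxp, inner_smul_left,
        inner_smul_right, hxe]
      simp
    refine lt_of_pow_lt_pow_left₀ 2 (by positivity) ?_
    rw [mul_pow, hw, hd, hpk]
    nlinarith [mul_pos (sub_pos.mpr hk1) (pow_pos hte 2), pow_pos hte 2]
  intro hconv
  have hmid := hconv (hmem (ε / 2) (by positivity) (by rw [abs_of_pos] <;> linarith))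
    (hmem (-(ε / 2)) (by linarith) (by rw [abs_neg, abs_of_pos] <;> linarith))
    (by norm_num : (0 : ℝ) ≤ 1 / 2) (by norm_num : (0 : ℝ) ≤ 1 / 2) (by norm_num)
  have hpmid : (1 / 2 : ℝ) • (p + (ε / 2) • e) + (1 / 2 : ℝ) • (p + (-(ε / 2)) • e) = p := by
    module
  rw [hpmid, hball p hpU, hpk] at hmid
  exact lt_irrefl _ hmid
end

section
/- Let n ≥ 2, let x_1, …, x_m ∈ ℝ^n with m ≥ 2 and x_1 ≠ x_2, let G = ℝ^n \ {x_1, …, x_m}, let x ∈ G and r > 0. If r ≤ log(1 + (min over i ≠ j of |x_i − x_j|) / (max over i of |x − x_i|)), then the ball B_δ(x,r) of Seittenranta's metric is convex. -/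
/-- Seittenranta's distance in `G = ℝⁿ \ {p 0, …, p (m−1)}`:
`δ_G(x,w) = max_{a,b ∈ F} log (1 + |a−b||x−w| / (|a−x||w−b|))` where
`F = {p 0, …, p (m−1)}`. -/
noncomputable def seitFinPunctured {n m : ℕ} (p : Fin m → EuclideanSpace ℝ (Fin n))
    (x w : EuclideanSpace ℝ (Fin n)) : ℝ :=
  sSup {t : ℝ | ∃ i j : Fin m,
    t = Real.log (1 + dist (p i) (p j) * dist x w / (dist (p i) x * dist w (p j)))}

/-- Stewart's theorem, in the form of a convex combination of two points. -/
theorem dist_sq_convex_combination {E : Type*} [NormedAddCommGroup E] [InnerProductSpace ℝ E]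
    (u v z : E) {a b : ℝ} (hab : a + b = 1) :
    dist (a • u + b • v) z ^ 2 =
      a * dist u z ^ 2 + b * dist v z ^ 2 - a * b * dist u v ^ 2 := by
  have h₁ : a • u + b • v - z = a • (u - z) + b • (v - z) := by
    obtain rfl : b = 1 - a := by linarith
    module
  have h₂ : u - v = (u - z) - (v - z) := by abel
  rw [dist_eq_norm, dist_eq_norm, dist_eq_norm, dist_eq_norm, h₁, h₂, norm_add_sq_real,
    norm_sub_sq_real (u - z), norm_smul, norm_smul, real_inner_smul_left, real_inner_smul_right,
    mul_pow, mul_pow, Real.norm_eq_abs, Real.norm_eq_abs, sq_abs, sq_abs]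
  obtain rfl : b = 1 - a := by linarith
  ring

/-- For `0 ≤ c ≤ 1`, the Apollonian domain of points whose distance to `x` is less than `c` times
their distance to `q` is convex. -/
theorem convex_setOf_dist_lt_mul_dist {E : Type*} [NormedAddCommGroup E] [InnerProductSpace ℝ E]
    (x q : E) {c : ℝ} (hc₀ : 0 ≤ c) (hc₁ : c ≤ 1) :
    Convex ℝ {w : E | dist w x < c * dist w q} := by
  intro u hu v hv a b ha hb hab
  have sq_lt {w : E} (hw : dist w x < c * dist w q) : dist w x ^ 2 < c ^ 2 * dist w q ^ 2 := by
    rw [← mul_pow]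
    exact pow_lt_pow_left₀ hw dist_nonneg two_ne_zero
  have hu' := sq_lt hu
  have hv' := sq_lt hv
  refine lt_of_pow_lt_pow_left₀ 2 (mul_nonneg hc₀ dist_nonneg) ?_
  rw [mul_pow, dist_sq_convex_combination u v x hab, dist_sq_convex_combination u v q hab]
  have hc : c ^ 2 ≤ 1 := pow_le_one₀ hc₀ hc₁
  have h : 0 ≤ (1 - c ^ 2) * (a * b * dist u v ^ 2) :=
    mul_nonneg (by linarith) (by positivity)
  have key : a * dist u x ^ 2 + b * dist v x ^ 2 <
      a * (c ^ 2 * dist u q ^ 2) + b * (c ^ 2 * dist v q ^ 2) := by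
    rcases ha.eq_or_lt with rfl | ha
    · obtain rfl : b = 1 := by linarith
      linarith
    · exact add_lt_add_of_lt_of_le (mul_lt_mul_of_pos_left hu' ha)
        (mul_le_mul_of_nonneg_left hv'.le hb)
  linarith

theorem seitFinPunctured_lt_iff {n m : ℕ} [NeZero m] (p : Fin m → EuclideanSpace ℝ (Fin n))
    (x w : EuclideanSpace ℝ (Fin n)) (r : ℝ) :
    seitFinPunctured p x w < r ↔ ∀ i j : Fin m,
      Real.log (1 + dist (p i) (p j) * dist x w / (dist (p i) x * dist w (p j))) < r := by
  have hfin : {t : ℝ | ∃ i j : Fin m, t = Real.log (1 + dist (p i) (p j) * dist x w /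
      (dist (p i) x * dist w (p j)))}.Finite := by
    refine (Set.finite_range fun k : Fin m × Fin m ↦ Real.log (1 + dist (p k.1) (p k.2) *
      dist x w / (dist (p k.1) x * dist w (p k.2)))).subset ?_
    rintro t ⟨i, j, rfl⟩
    exact ⟨(i, j), rfl⟩
  rw [seitFinPunctured, hfin.csSup_lt_iff ⟨_, 0, 0, rfl⟩]
  exact ⟨fun h i j ↦ h _ ⟨i, j, rfl⟩, by rintro h _ ⟨i, j, rfl⟩; exact h i j⟩

theorem mul_dist_le_dist_of_le_log {E : Type*} [MetricSpace E] {m : ℕ} (p : Fin m → E) {x : E}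
    (hx : x ∉ Set.range p) {r : ℝ}
    (hle : r ≤ Real.log (1 +
      sInf {d : ℝ | ∃ i j : Fin m, i ≠ j ∧ d = dist (p i) (p j)} /
      sSup {d : ℝ | ∃ i : Fin m, d = dist x (p i)})) (hr : 0 < r) {i j : Fin m} (hij : i ≠ j) :
    (Real.exp r - 1) * dist (p i) x ≤ dist (p i) (p j) := by
  set δ := sInf {d : ℝ | ∃ i j : Fin m, i ≠ j ∧ d = dist (p i) (p j)}
  set D := sSup {d : ℝ | ∃ i : Fin m, d = dist x (p i)}
  have hδ₀ : 0 ≤ δ := Real.sInf_nonneg (by rintro _ ⟨i, j, -, rfl⟩; exact dist_nonneg)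
  have hδ : δ ≤ dist (p i) (p j) :=
    csInf_le ⟨0, by rintro _ ⟨i, j, -, rfl⟩; exact dist_nonneg⟩ ⟨i, j, hij, rfl⟩
  have hD : dist (p i) x ≤ D := by
    rw [dist_comm]
    refine le_csSup (Set.Finite.bddAbove ?_) ⟨i, rfl⟩
    exact (Set.finite_range fun k ↦ dist x (p k)).subset fun _ ⟨k, hk⟩ ↦ ⟨k, hk.symm⟩
  have hix : 0 < dist (p i) x := dist_pos.2 fun h ↦ hx ⟨i, h⟩
  have hD₀ : 0 < D := hix.trans_le hD
  have hR₀ : 0 < Real.exp r - 1 := sub_pos.2 (Real.one_lt_exp_iff.2 hr)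
  have hR : Real.exp r - 1 ≤ δ / D := by
    have := (Real.le_log_iff_exp_le (by positivity)).1 hle
    linarith
  calc (Real.exp r - 1) * dist (p i) x ≤ (Real.exp r - 1) * D := by gcongr
    _ ≤ δ := (le_div_iff₀ hD₀).1 hR
    _ ≤ dist (p i) (p j) := hδ

/-- In `G = ℝⁿ \ {x_1, …, x_m}` (`n ≥ 2`, `m ≥ 2`, `x_1 ≠ x_2`), with `x ∈ G` and
`r ≤ log (1 + min_{i ≠ j} |x_i − x_j| / max_i |x − x_i|)`, the ball `B_δ(x,r)` of
Seittenranta's metric is convex. -/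
theorem seittenranta_ball_finitely_punctured_convex
    (n m : ℕ) (hn : 2 ≤ n) (hm : 2 ≤ m)
    (p : Fin m → EuclideanSpace ℝ (Fin n))
    (hp : p ⟨0, by omega⟩ ≠ p ⟨1, by omega⟩)
    (x : EuclideanSpace ℝ (Fin n)) (hx : x ∉ Set.range p)
    (r : ℝ) (hr : 0 < r)
    (hle : r ≤ Real.log (1 +
      sInf {d : ℝ | ∃ i j : Fin m, i ≠ j ∧ d = dist (p i) (p j)} /
      sSup {d : ℝ | ∃ i : Fin m, d = dist x (p i)})) :
    Convex ℝ {w : EuclideanSpace ℝ (Fin n) |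
      w ∉ Set.range p ∧ seitFinPunctured p x w < r} := by
  have hR₀ : 0 < Real.exp r - 1 := sub_pos.2 (Real.one_lt_exp_iff.2 hr)
  have : NeZero m := ⟨by omega⟩
  have : Nontrivial (Fin m) := Fin.nontrivial_iff_two_le.2 hm
  have hpx (i : Fin m) : 0 < dist (p i) x := dist_pos.2 fun h ↦ hx ⟨i, h⟩
  have hpp {i j : Fin m} (hij : i ≠ j) : 0 < dist (p i) (p j) :=
    (mul_pos hR₀ (hpx i)).trans_le (mul_dist_le_dist_of_le_log p hx hle hr hij)
  have log_lt_iff {w : EuclideanSpace ℝ (Fin n)} {i j : Fin m} (hij : i ≠ j) (hw : w ≠ p j) :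
      Real.log (1 + dist (p i) (p j) * dist x w / (dist (p i) x * dist w (p j))) < r ↔
        dist w x < (Real.exp r - 1) * dist (p i) x / dist (p i) (p j) * dist w (p j) := by
    have hwj : 0 < dist w (p j) := dist_pos.2 hw
    have := hpx i
    have := hpp hij
    rw [Real.log_lt_iff_lt_exp (by positivity), ← lt_sub_iff_add_lt', div_lt_iff₀ (by positivity),
      div_mul_eq_mul_div, lt_div_iff₀ (hpp hij), dist_comm x w, mul_comm (dist w x), mul_assoc]
  have hset : {w : EuclideanSpace ℝ (Fin n) | w ∉ Set.range p ∧ seitFinPunctured p x w < r} =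
      ⋂ (i : Fin m) (j : Fin m) (_ : i ≠ j), {w | dist w x <
        (Real.exp r - 1) * dist (p i) x / dist (p i) (p j) * dist w (p j)} := by
    ext w
    simp only [Set.mem_ofPred_eq, Set.mem_iInter, seitFinPunctured_lt_iff]
    constructor
    · rintro ⟨hw, h⟩ i j hij
      exact (log_lt_iff hij fun h' ↦ hw ⟨j, h'.symm⟩).1 (h i j)
    · intro h
      have hw (j : Fin m) : w ≠ p j := by
        rintro rfl
        obtain ⟨i, hij⟩ := exists_ne j
        have := h i j hij
        rw [dist_self, mul_zero] at this
        exact this.not_ge dist_nonneg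
      refine ⟨fun ⟨j, hj⟩ ↦ hw j hj.symm, fun i j ↦ ?_⟩
      by_cases hij : i = j
      · simpa [hij] using hr
      · exact (log_lt_iff hij (hw j)).2 (h i j hij)
  rw [hset]
  refine convex_iInter fun i ↦ convex_iInter fun j ↦ convex_iInter fun hij ↦
    convex_setOf_dist_lt_mul_dist x (p j) (by positivity) ?_
  exact div_le_one_of_le₀ (mul_dist_le_dist_of_le_log p hx hle hr hij) dist_nonneg
end

section
/- Let n ≥ 2, let x, y ∈ ℝ^n with x ≠ y, and let r ∈ (0,1). For t ∈ (0,1] put z_t = x + t(y−x). Then the union over t ∈ (0,1] of the open balls D^r_{x,z_t} equals A ∪ D^r_{x,y}, where A = { a ∈ ℝ^n : a ≠ x, ∠(a,x,y) < arcsin r, |a−x| < |x−y|/√(1−r²) } and ∠(a,x,y) denotes the Euclidean angle at the vertex x between the vectors a−x and y−x. -/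
open InnerProductGeometry in
/-- The angle between nonzero vectors is below `arcsin r` iff its cosine exceeds `√(1 - r²)`. -/
theorem angle_lt_arcsin_iff {V : Type*} [NormedAddCommGroup V] [InnerProductSpace ℝ V]
    {u v : V} (hu : u ≠ 0) (hv : v ≠ 0) {r : ℝ} (hr : 0 ≤ r) :
    angle u v < Real.arcsin r ↔ Real.sqrt (1 - r ^ 2) * (‖u‖ * ‖v‖) < inner ℝ u v := by
  have hpos : 0 < ‖u‖ * ‖v‖ := mul_pos (norm_pos_iff.2 hu) (norm_pos_iff.2 hv)
  have harc : Real.arcsin r ∈ Set.Icc 0 Real.pi :=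
    ⟨Real.arcsin_nonneg.2 hr, (Real.arcsin_le_pi_div_two r).trans (by linarith [Real.pi_pos])⟩
  have hang : angle u v ∈ Set.Icc 0 Real.pi := ⟨angle_nonneg u v, angle_le_pi u v⟩
  rw [← Real.strictAntiOn_cos.lt_iff_gt harc hang, Real.cos_arcsin, cos_angle, lt_div_iff₀ hpos]

/-- Membership in the ball `{u | ‖t v - u‖ < r ‖u‖}` as a quadratic inequality in `t`. -/
theorem norm_smul_sub_lt_mul_norm_iff {V : Type*} [NormedAddCommGroup V] [InnerProductSpace ℝ V]
    (u v : V) (t : ℝ) {r : ℝ} (hr : 0 ≤ r) :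
    ‖t • v - u‖ < r * ‖u‖ ↔
      (1 - r ^ 2) * ‖u‖ ^ 2 + t ^ 2 * ‖v‖ ^ 2 < 2 * t * inner ℝ u v := by
  rw [← sq_lt_sq₀ (norm_nonneg _) (by positivity), norm_sub_sq_real, norm_smul, mul_pow,
    Real.norm_eq_abs, sq_abs, real_inner_smul_left, real_inner_comm]
  constructor <;> intro h <;> linarith

/-- If `m² + t² L² < 2 t p` for some `t > 0`, then `m L < p`. -/
theorem mul_lt_of_sq_add_sq_lt {m L p t : ℝ} (ht : 0 < t)
    (h : m ^ 2 + t ^ 2 * L ^ 2 < 2 * t * p) : m * L < p := by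
  refine lt_of_mul_lt_mul_left (a := t) ?_ ht.le
  nlinarith [sq_nonneg (m - t * L)]

/-- If `L ≤ m`, a solution `t ∈ (0, 1]` of `m² + t² L² < 2 t p` forces `t = 1` to be one. -/
theorem sq_add_sq_lt_of_le {m L p t : ℝ} (ht : 0 < t) (ht1 : t ≤ 1) (hL : 0 ≤ L) (hLm : L ≤ m)
    (h : m ^ 2 + t ^ 2 * L ^ 2 < 2 * t * p) : m ^ 2 + L ^ 2 < 2 * p := by
  refine lt_of_mul_lt_mul_left (a := t) ?_ ht.le
  have h1 : L ^ 2 ≤ m ^ 2 := pow_le_pow_left₀ hL hLm 2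
  have h2 : t * L ^ 2 ≤ m ^ 2 := by nlinarith [sq_nonneg L]
  nlinarith [mul_nonneg (sub_nonneg.2 ht1) (sub_nonneg.2 h2)]

/-- Let `x ≠ y` in `ℝⁿ` (`n ≥ 2`) and `r ∈ (0,1)`. The union over `t ∈ (0,1]` of the
open Apollonian balls `D^r_{x, x+t(y−x)} = {w : |x+t(y−x)−w| < r|x−w|}` is the
"ice cream cone" `A ∪ D^r_{x,y}`, where
`A = {a ≠ x : ∠(a,x,y) < arcsin r, |a−x| < |x−y|/√(1−r²)}`. -/
theorem apollonian_balls_union_ice_cream_cone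
    (n : ℕ) (hn : 2 ≤ n) (x y : EuclideanSpace ℝ (Fin n)) (hxy : x ≠ y)
    (r : ℝ) (hr : r ∈ Set.Ioo (0 : ℝ) 1) :
    (⋃ t ∈ Set.Ioc (0 : ℝ) 1,
        {w : EuclideanSpace ℝ (Fin n) | dist (x + t • (y - x)) w < r * dist x w}) =
      {a : EuclideanSpace ℝ (Fin n) | a ≠ x ∧
          EuclideanGeometry.angle a x y < Real.arcsin r ∧
          dist a x < dist x y / Real.sqrt (1 - r ^ 2)} ∪
        {w : EuclideanSpace ℝ (Fin n) | dist y w < r * dist x w} := by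
  obtain ⟨hr0, hr1⟩ := hr
  have hk2 : 0 < 1 - r ^ 2 := by nlinarith
  have hv : y - x ≠ 0 := sub_ne_zero.2 hxy.symm
  have hL : 0 < ‖y - x‖ := norm_pos_iff.2 hv
  have hball (t : ℝ) (w : EuclideanSpace ℝ (Fin n)) :
      dist (x + t • (y - x)) w < r * dist x w ↔
        (Real.sqrt (1 - r ^ 2) * ‖w - x‖) ^ 2 + t ^ 2 * ‖y - x‖ ^ 2 <
          2 * t * inner ℝ (w - x) (y - x) := by
    rw [mul_pow, Real.sq_sqrt hk2.le, ← norm_smul_sub_lt_mul_norm_iff _ _ _ hr0.le,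
      dist_eq_norm, dist_comm x w, dist_eq_norm,
      show x + t • (y - x) - w = t • (y - x) - (w - x) by abel]
  have hone (w : EuclideanSpace ℝ (Fin n)) := hball 1 w
  simp only [one_smul, add_sub_cancel, one_pow, one_mul, mul_one] at hone
  have hk : 0 < Real.sqrt (1 - r ^ 2) := Real.sqrt_pos.2 hk2
  ext w
  simp only [Set.mem_iUnion, Set.mem_union, Set.mem_ofPred_eq, exists_prop, hball, hone]
  rw [dist_comm x y, lt_div_iff₀' hk, dist_eq_norm, dist_eq_norm]
  have hangle (hw : w ≠ x) : EuclideanGeometry.angle w x y < Real.arcsin r ↔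
      Real.sqrt (1 - r ^ 2) * (‖w - x‖ * ‖y - x‖) < inner ℝ (w - x) (y - x) :=
    angle_lt_arcsin_iff (sub_ne_zero.2 hw) hv hr0.le
  constructor
  · rintro ⟨t, ⟨ht, ht1⟩, h⟩
    rcases lt_or_ge (Real.sqrt (1 - r ^ 2) * ‖w - x‖) ‖y - x‖ with hlt | hle
    · have hw : w ≠ x := by
        rintro rfl
        simp only [sub_self, norm_zero, inner_zero_left] at h
        nlinarith [mul_pos (pow_pos ht 2) (pow_pos hL 2)]
      refine Or.inl ⟨hw, (hangle hw).2 ?_, hlt⟩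
      rw [← mul_assoc]
      exact mul_lt_of_sq_add_sq_lt ht h
    · exact Or.inr (sq_add_sq_lt_of_le ht ht1 hL.le hle h)
  · rintro (⟨hw, hang, hlt⟩ | h)
    · rw [hangle hw, ← mul_assoc] at hang
      have hm : 0 < Real.sqrt (1 - r ^ 2) * ‖w - x‖ :=
        mul_pos hk (norm_pos_iff.2 (sub_ne_zero.2 hw))
      refine ⟨Real.sqrt (1 - r ^ 2) * ‖w - x‖ / ‖y - x‖,
        ⟨div_pos hm hL, (div_le_one hL).2 hlt.le⟩, ?_⟩
      generalize Real.sqrt (1 - r ^ 2) * ‖w - x‖ = m at *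
      have h1 : (m / ‖y - x‖) ^ 2 * ‖y - x‖ ^ 2 = m ^ 2 := by field_simp
      have h2 : m / ‖y - x‖ * (m * ‖y - x‖) = m ^ 2 := by field_simp
      have h3 := mul_lt_mul_of_pos_left hang (div_pos hm hL)
      linarith
    · exact ⟨1, ⟨one_pos, le_rfl⟩, by simpa using h⟩
end

section
/- Let n ≥ 2, let e_1 be the first standard unit vector of ℝ^n, and let G = ℝ^n \ {−e_1, e_1}. Then for all x, w ∈ G satisfying |w+e_1||x−e_1| = |w−e_1||x+e_1| one has α_G(x,w) = 0. In particular, α_G is not a metric on G. -/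
/-- The Apollonian distance vanishes on pairs of points that have the same ratio of distances
to the two punctures. -/
theorem apoTwice_eq_zero {n : ℕ} {y z x w : EuclideanSpace ℝ (Fin n)}
    (hxy : x ≠ y) (hxz : x ≠ z) (hwy : w ≠ y) (hwz : w ≠ z)
    (h : dist w y * dist x z = dist w z * dist x y) : apoTwice y z x w = 0 := by
  have h₁ := dist_ne_zero.2 hxy
  have h₂ := dist_ne_zero.2 hxz
  have h₃ := dist_ne_zero.2 hwy
  have h₄ := dist_ne_zero.2 hwz
  have hyy : dist w y * dist x y / (dist x y * dist w y) = 1 := by field_simp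
  have hyz : dist w y * dist x z / (dist x y * dist w z) = 1 := by rw [h]; field_simp
  have hzy : dist w z * dist x y / (dist x z * dist w y) = 1 := by rw [← h]; field_simp
  have hzz : dist w z * dist x z / (dist x z * dist w z) = 1 := by field_simp
  simp only [apoTwice, dist_comm y, dist_comm z, hyy, hyz, hzy, hzz, Real.log_one, max_self]

/-- In `G = ℝⁿ \ {−e₁, e₁}` (`n ≥ 2`), any `x, w ∈ G` with
`|w+e₁||x−e₁| = |w−e₁||x+e₁|` satisfy `α_G(x,w) = 0`; in particular `α_G`
vanishes on a pair of distinct points of `G`, so it is not a metric on `G`. -/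
theorem apollonian_twice_punctured_zero_not_metric (n : ℕ) (hn : 2 ≤ n) :
    let e1 : EuclideanSpace ℝ (Fin n) := EuclideanSpace.single ⟨0, by omega⟩ 1
    (∀ x w : EuclideanSpace ℝ (Fin n),
      x ≠ -e1 → x ≠ e1 → w ≠ -e1 → w ≠ e1 →
      dist w (-e1) * dist x e1 = dist w e1 * dist x (-e1) →
      apoTwice (-e1) e1 x w = 0) ∧
    ∃ x w : EuclideanSpace ℝ (Fin n),
      x ≠ -e1 ∧ x ≠ e1 ∧ w ≠ -e1 ∧ w ≠ e1 ∧ x ≠ w ∧ apoTwice (-e1) e1 x w = 0 := by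
  intro e1
  have key : ∀ x w : EuclideanSpace ℝ (Fin n),
      x ≠ -e1 → x ≠ e1 → w ≠ -e1 → w ≠ e1 →
      dist w (-e1) * dist x e1 = dist w e1 * dist x (-e1) →
      apoTwice (-e1) e1 x w = 0 :=
    fun _ _ hxy hxz hwy hwz h => apoTwice_eq_zero hxy hxz hwy hwz h
  let e2 : EuclideanSpace ℝ (Fin n) := EuclideanSpace.single ⟨1, by omega⟩ 1
  have he1 : e1 ≠ 0 := by simp [e1]
  have he2 : e2 ≠ 0 := by simp [e2]
  have horth : inner ℝ e2 e1 = 0 := by simp [e1, e2, EuclideanSpace.inner_single_left]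
  have hself : inner ℝ e2 e2 ≠ 0 := inner_self_ne_zero.2 he2
  have h₁ : e2 ≠ -e1 := fun h => hself (by nth_rw 2 [h]; rw [inner_neg_right, horth, neg_zero])
  have h₂ : e2 ≠ e1 := fun h => hself (by nth_rw 2 [h]; exact horth)
  have h₃ : (0 : EuclideanSpace ℝ (Fin n)) ≠ -e1 := (neg_ne_zero.2 he1).symm
  refine ⟨key, 0, e2, h₃, he1.symm, h₁, h₂, he2.symm, key 0 e2 h₃ he1.symm h₁ h₂ ?_⟩
  rw [dist_zero_left, dist_zero_left, norm_neg, dist_eq_norm, dist_eq_norm, sub_neg_eq_add,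
    norm_sub_eq_norm_add (by rw [real_inner_comm, horth])]
end

section
/- Let n ≥ 2, let y, z ∈ ℝ^n with y ≠ z, let G = ℝ^n \ {y, z}, x ∈ G and r > 0. Put c = e^r |x−z|/|x−y| and d = e^r |x−y|/|x−z|. Then B_α(x,r) = { w ∈ ℝ^n : |w−z| < c|w−y| and |w−y| < d|w−z| }; equivalently, B_α(x,r) is the complement in ℝ^n of the union of the two closed Apollonian regions { w : c|w−y| ≤ |w−z| } and { w : d|w−z| ≤ |w−y| }. -/
theorem log_div_lt_iff_lt_exp_mul_div_mul {p q s t r : ℝ} (hp : 0 < p) (hq : 0 < q)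
    (hs : 0 < s) (ht : 0 < t) :
    Real.log (p * q / (s * t)) < r ↔ p < Real.exp r * s / q * t := by
  rw [Real.log_lt_iff_lt_exp (by positivity), div_lt_iff₀ (by positivity), div_mul_eq_mul_div,
    lt_div_iff₀ hq, mul_assoc (Real.exp r)]

theorem apoTwice_lt_iff {n : ℕ} {y z x w : EuclideanSpace ℝ (Fin n)} (hxy : x ≠ y)
    (hxz : x ≠ z) (hwy : w ≠ y) (hwz : w ≠ z) {r : ℝ} (hr : 0 < r) :
    apoTwice y z x w < r ↔
      dist w z < Real.exp r * dist x z / dist x y * dist w y ∧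
      dist w y < Real.exp r * dist x y / dist x z * dist w z := by
  have hxy := dist_pos.2 hxy
  have hxz := dist_pos.2 hxz
  have hwy := dist_pos.2 hwy
  have hwz := dist_pos.2 hwz
  have diag {p q : ℝ} (hp : 0 < p) (hq : 0 < q) : Real.log (p * q / (q * p)) < r := by
    rwa [mul_comm q p, div_self (by positivity), Real.log_one]
  simp only [apoTwice, dist_comm y, dist_comm z, max_lt_iff, diag hwy hxy, diag hwz hxz,
    log_div_lt_iff_lt_exp_mul_div_mul hwy hxz hxy hwz,
    log_div_lt_iff_lt_exp_mul_div_mul hwz hxy hxz hwy, true_and, and_true]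
  exact and_comm

/-- In `G = ℝⁿ \ {y, z}` (`y ≠ z`, `n ≥ 2`), for `x ∈ G` and `r > 0`, setting
`c = eʳ|x−z|/|x−y|` and `d = eʳ|x−y|/|x−z|`, the Apollonian ball `B_α(x,r)` equals
`{w : |w−z| < c|w−y| ∧ |w−y| < d|w−z|}`; equivalently, it is the complement of the
union of the two closed Apollonian regions `{w : c|w−y| ≤ |w−z|}` and
`{w : d|w−z| ≤ |w−y|}`. -/
theorem apollonian_ball_twice_punctured_formula
    (n : ℕ) (hn : 2 ≤ n) (y z : EuclideanSpace ℝ (Fin n)) (hyz : y ≠ z)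
    (x : EuclideanSpace ℝ (Fin n)) (hx : x ≠ y ∧ x ≠ z) (r : ℝ) (hr : 0 < r) :
    {w : EuclideanSpace ℝ (Fin n) | (w ≠ y ∧ w ≠ z) ∧ apoTwice y z x w < r} =
      {w : EuclideanSpace ℝ (Fin n) |
        dist w z < Real.exp r * dist x z / dist x y * dist w y ∧
        dist w y < Real.exp r * dist x y / dist x z * dist w z} ∧
    {w : EuclideanSpace ℝ (Fin n) | (w ≠ y ∧ w ≠ z) ∧ apoTwice y z x w < r} =
      ({w : EuclideanSpace ℝ (Fin n) |
          Real.exp r * dist x z / dist x y * dist w y ≤ dist w z} ∪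
        {w : EuclideanSpace ℝ (Fin n) |
          Real.exp r * dist x y / dist x z * dist w z ≤ dist w y})ᶜ := by
  rw [← Set.ofPred_or, Set.compl_ofPred]
  simp only [not_or, not_le, and_self]
  ext w
  simp only [Set.mem_ofPred_eq]
  constructor
  · rintro ⟨⟨hwy, hwz⟩, h⟩
    exact (apoTwice_lt_iff hx.1 hx.2 hwy hwz hr).1 h
  · intro h
    have hwy : w ≠ y := by
      rintro rfl
      simpa using dist_nonneg.trans_lt h.1
    have hwz : w ≠ z := by
      rintro rfl
      simpa using dist_nonneg.trans_lt h.2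
    exact ⟨⟨hwy, hwz⟩, (apoTwice_lt_iff hx.1 hx.2 hwy hwz hr).2 h⟩
end

section
/- Let n ≥ 2, let y, z ∈ ℝ^n with y ≠ z, let G = ℝ^n \ {y, z}, x ∈ G, and let r_1 = log(1 + |y−z| / max{|x−y|, |x−z|}). Then for every r with 0 < r < r_1 the ball B_δ(x,r) is strictly convex, i.e. B_δ(x,r) is convex and for any two distinct points u, v in the closure of B_δ(x,r) the open segment between u and v is contained in the interior of B_δ(x,r). -/
/-- Seittenranta's distance in the twice punctured space `ℝⁿ \ {y, z}`:
the maximum over boundary points `a, b ∈ {y, z}` of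
`log (1 + |a−b||x−w| / (|a−x||w−b|))`. -/
noncomputable def seitTwice {n : ℕ} (y z x w : EuclideanSpace ℝ (Fin n)) : ℝ :=
  max
    (max (Real.log (1 + dist y y * dist x w / (dist y x * dist w y)))
         (Real.log (1 + dist y z * dist x w / (dist y x * dist w z))))
    (max (Real.log (1 + dist z y * dist x w / (dist z x * dist w y)))
         (Real.log (1 + dist z z * dist x w / (dist z x * dist w z))))

/-- For `0 < k < 1`, the region `|x - w| < k |w - p|` is an open (Apollonian) ball. -/
lemma dist_lt_mul_dist_iff_mem_ball {E : Type*} [NormedAddCommGroup E] [InnerProductSpace ℝ E]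
    {k : ℝ} (hk0 : 0 < k) (hk1 : k < 1) (x p w : E) :
    dist x w < k * dist w p ↔
      w ∈ Metric.ball ((1 - k ^ 2)⁻¹ • (x - k ^ 2 • p)) (k * dist x p / (1 - k ^ 2)) := by
  have hk : 0 < 1 - k ^ 2 := by nlinarith
  have hw : w - (1 - k ^ 2)⁻¹ • (x - k ^ 2 • p)
      = (1 - k ^ 2)⁻¹ • ((w - x) - k ^ 2 • (w - p)) := by
    have : (w - x) - k ^ 2 • (w - p) = (1 - k ^ 2) • w - (x - k ^ 2 • p) := by module
    rw [this, smul_sub _ ((1 - k ^ 2) • w), inv_smul_smul₀ hk.ne']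
  have hxp : x - p = (w - p) - (w - x) := by abel
  rw [Metric.mem_ball, dist_eq_norm w (_ • _), hw, norm_smul, Real.norm_of_nonneg (inv_nonneg.2 hk.le),
    lt_div_iff₀ hk, mul_comm _ (1 - k ^ 2), ← mul_assoc, mul_inv_cancel₀ hk.ne', one_mul, dist_comm x w,
    dist_eq_norm, dist_eq_norm, dist_eq_norm, hxp]
  generalize w - x = a
  generalize w - p = b
  have h1 := norm_sub_sq_real a (k ^ 2 • b)
  have h2 := norm_sub_sq_real b a
  rw [norm_smul, inner_smul_right, Real.norm_of_nonneg (sq_nonneg k)] at h1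
  rw [real_inner_comm] at h2
  rw [← sq_lt_sq₀ (norm_nonneg _) (by positivity),
    ← sq_lt_sq₀ (norm_nonneg (a - _)) (by positivity), mul_pow k ‖b - a‖, h1, h2,
    ← sub_pos, ← sub_pos (b := _ + _)]
  have : k ^ 2 * (‖b‖ ^ 2 - 2 * inner ℝ a b + ‖a‖ ^ 2)
      - (‖a‖ ^ 2 - 2 * (k ^ 2 * inner ℝ a b) + (k ^ 2 * ‖b‖) ^ 2)
      = (1 - k ^ 2) * ((k * ‖b‖) ^ 2 - ‖a‖ ^ 2) := by ring
  rw [this, mul_pos_iff_of_pos_left hk]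

/-- One term of Seittenranta's distance is below `r` exactly in an Apollonian region. -/
lemma log_one_add_div_lt_iff {D d e f r : ℝ} (hD : 0 < D) (hd : 0 ≤ d) (he : 0 < e)
    (hf : 0 < f) :
    Real.log (1 + D * d / (e * f)) < r ↔ d < (Real.exp r - 1) * e / D * f := by
  rw [Real.log_lt_iff_lt_exp (by positivity), ← lt_sub_iff_add_lt', div_lt_iff₀ (by positivity),
    mul_comm D d, ← lt_div_iff₀ hD]
  ring_nf

/-- The intersection of two open balls is strictly convex: an open segment between distinct
points of the closure lies in the intersection. -/
lemma openSegment_subset_ball_inter_ball {E : Type*} [NormedAddCommGroup E] [NormedSpace ℝ E]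
    [StrictConvexSpace ℝ E] {c₁ c₂ u v : E} {r₁ r₂ : ℝ}
    (hu : u ∈ closure (Metric.ball c₁ r₁ ∩ Metric.ball c₂ r₂))
    (hv : v ∈ closure (Metric.ball c₁ r₁ ∩ Metric.ball c₂ r₂)) (huv : u ≠ v) :
    openSegment ℝ u v ⊆ Metric.ball c₁ r₁ ∩ Metric.ball c₂ r₂ := by
  obtain ⟨w, hw₁, hw₂⟩ := closure_nonempty_iff.1 ⟨u, hu⟩
  have key : ∀ {c : E} {r : ℝ}, 0 < r → u ∈ closure (Metric.ball c r) →
      v ∈ closure (Metric.ball c r) → openSegment ℝ u v ⊆ Metric.ball c r := by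
    intro c r hr hu hv
    rw [← interior_closedBall c hr.ne']
    exact (strictConvex_closedBall ℝ c r).openSegment_subset
      (Metric.closure_ball_subset_closedBall hu) (Metric.closure_ball_subset_closedBall hv) huv
  exact Set.subset_inter
    (key (Metric.pos_of_mem_ball hw₁) (closure_mono Set.inter_subset_left hu)
      (closure_mono Set.inter_subset_left hv))
    (key (Metric.pos_of_mem_ball hw₂) (closure_mono Set.inter_subset_right hu)
      (closure_mono Set.inter_subset_right hv))

/-- Small Seittenranta balls in the twice punctured space are intersections of two open balls. -/
lemma exists_seitTwice_ball_eq_inter {n : ℕ} {y z x : EuclideanSpace ℝ (Fin n)} (hyz : y ≠ z)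
    (hx : x ≠ y ∧ x ≠ z) {r : ℝ} (hr : 0 < r)
    (hr1 : r < Real.log (1 + dist y z / max (dist x y) (dist x z))) :
    ∃ (c₁ c₂ : EuclideanSpace ℝ (Fin n)) (r₁ r₂ : ℝ),
      {w : EuclideanSpace ℝ (Fin n) | (w ≠ y ∧ w ≠ z) ∧ seitTwice y z x w < r}
        = Metric.ball c₁ r₁ ∩ Metric.ball c₂ r₂ := by
  have hD : 0 < dist y z := dist_pos.2 hyz
  have hxy : 0 < dist x y := dist_pos.2 hx.1
  have hxz : 0 < dist x z := dist_pos.2 hx.2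
  have hm : 0 < max (dist x y) (dist x z) := lt_max_of_lt_left hxy
  have hR : 0 < Real.exp r - 1 := sub_pos.2 (Real.one_lt_exp_iff.2 hr)
  rw [Real.lt_log_iff_exp_lt (by positivity), ← sub_lt_iff_lt_add', lt_div_iff₀ hm] at hr1
  have hk : ∀ d, 0 < d → d ≤ max (dist x y) (dist x z) →
      0 < (Real.exp r - 1) * d / dist y z ∧ (Real.exp r - 1) * d / dist y z < 1 := by
    intro d hd hdm
    refine ⟨by positivity, ?_⟩
    rw [div_lt_one hD]
    exact (mul_le_mul_of_nonneg_left hdm hR.le).trans_lt hr1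
  obtain ⟨hy0, hy1⟩ := hk _ hxy (le_max_left _ _)
  obtain ⟨hz0, hz1⟩ := hk _ hxz (le_max_right _ _)
  refine ⟨_, _, _, _, Set.ext fun w => Iff.trans ?_
    (and_congr (dist_lt_mul_dist_iff_mem_ball hy0 hy1 x z w)
      (dist_lt_mul_dist_iff_mem_ball hz0 hz1 x y w))⟩
  by_cases hwy : w = y
  · simp [hwy, hxy.le]
  by_cases hwz : w = z
  · simp [hwz, hxz.le]
  have h1 := log_one_add_div_lt_iff (r := r) hD (dist_nonneg (x := x) (y := w)) hxy
    (dist_pos.2 hwz)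
  have h2 := log_one_add_div_lt_iff (r := r) hD (dist_nonneg (x := x) (y := w)) hxz
    (dist_pos.2 hwy)
  simp [seitTwice, hwy, hwz, hr, dist_comm y x, dist_comm z x, dist_comm z y, h1, h2]

/-- In `G = ℝⁿ \ {y, z}` (`y ≠ z`, `n ≥ 2`), for `x ∈ G` and
`r₁ = log (1 + |y−z| / max (|x−y|, |x−z|))`, the Seittenranta ball `B_δ(x,r)` is
strictly convex for every `0 < r < r₁`: it is convex, and the open segment
between any two distinct points of its closure lies in its interior. -/
theorem seittenranta_ball_twice_punctured_strictly_convex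
    (n : ℕ) (hn : 2 ≤ n) (y z : EuclideanSpace ℝ (Fin n)) (hyz : y ≠ z)
    (x : EuclideanSpace ℝ (Fin n)) (hx : x ≠ y ∧ x ≠ z) (r : ℝ) (hr : 0 < r)
    (hr1 : r < Real.log (1 + dist y z / max (dist x y) (dist x z))) :
    Convex ℝ {w : EuclideanSpace ℝ (Fin n) |
      (w ≠ y ∧ w ≠ z) ∧ seitTwice y z x w < r} ∧
    ∀ u ∈ closure {w : EuclideanSpace ℝ (Fin n) |
        (w ≠ y ∧ w ≠ z) ∧ seitTwice y z x w < r},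
      ∀ v ∈ closure {w : EuclideanSpace ℝ (Fin n) |
        (w ≠ y ∧ w ≠ z) ∧ seitTwice y z x w < r},
      u ≠ v →
        openSegment ℝ u v ⊆
          interior {w : EuclideanSpace ℝ (Fin n) |
            (w ≠ y ∧ w ≠ z) ∧ seitTwice y z x w < r} := by
  obtain ⟨c₁, c₂, r₁, r₂, h⟩ := exists_seitTwice_ball_eq_inter hyz hx hr hr1
  rw [h, (Metric.isOpen_ball.inter Metric.isOpen_ball).interior_eq]
  exact ⟨(convex_ball c₁ r₁).inter (convex_ball c₂ r₂),
    fun u hu v hv huv => openSegment_subset_ball_inter_ball hu hv huv⟩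
end

section
/- Let n ≥ 2, let 𝔹^n be the open Euclidean unit ball in ℝ^n, let x ∈ 𝔹^n with x ≠ 0, and let r > 0. Define A = { y ∈ 𝔹^n : |x−y| < (e^r − 1)(1−|x|)|y| }. Then A is convex if r ≤ log(1 + 1/(1−|x|)), and A is not convex if r > log(1 + 1/(1−|x|)). -/
open scoped RealInnerProductSpace

section Apollonius

variable {E : Type*} [NormedAddCommGroup E] [InnerProductSpace ℝ E]

/-- For `0 ≤ c ≤ 1` the Apollonian set `{y | dist x y < c * ‖y‖}` is convex. -/
theorem convex_setOf_dist_lt_mul_norm (x : E) {c : ℝ} (hc0 : 0 ≤ c) (hc1 : c ≤ 1) :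
    Convex ℝ {y : E | dist x y < c * ‖y‖} := by
  have hset : {y : E | dist x y < c * ‖y‖} =
      {y ∈ Set.univ | ‖x‖ ^ 2 - 2 * ⟪x, y⟫ + (1 - c ^ 2) * ‖y‖ ^ 2 < 0} := by
    ext y
    simp only [Set.mem_ofPred_eq, Set.mem_univ, true_and]
    rw [dist_eq_norm, ← sq_lt_sq₀ (norm_nonneg _) (by positivity), norm_sub_sq_real, mul_pow]
    constructor <;> intro h <;> linarith
  rw [hset]
  refine ConvexOn.convex_lt (ConvexOn.add (ConvexOn.sub (convexOn_const _ convex_univ) ?_) ?_) 0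
  · exact ((2 : ℝ) • (innerₛₗ ℝ x)).concaveOn convex_univ
  · exact ((convexOn_norm convex_univ).pow (fun _ _ => norm_nonneg _) 2).smul
      (sub_nonneg.2 (pow_le_one₀ hc0 hc1))

/-- For `1 < c` the part of the Apollonian set `{y | dist x y < c * ‖y‖}` in the unit ball is not
convex, provided there is a direction orthogonal to `x`. -/
theorem not_convex_setOf_dist_lt_mul_norm {x v : E} (hx : ‖x‖ < 1) (hv : ‖v‖ = 1)
    (hxv : ⟪x, v⟫ = 0) {c : ℝ} (hc : 1 < c) :
    ¬ Convex ℝ {y : E | y ∈ Metric.ball 0 1 ∧ dist x y < c * ‖y‖} := by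
  have hpos : 0 < c + 1 := by linarith
  set p : E := (c + 1)⁻¹ • x with hp
  have hxp : x - p = c • p := by
    rw [hp, smul_smul, sub_eq_iff_eq_add, ← add_smul]
    have : c * (c + 1)⁻¹ + (c + 1)⁻¹ = 1 := by field_simp
    rw [this, one_smul]
  have hpnorm : ‖p‖ < 1 / 2 := by
    rw [hp, norm_smul, Real.norm_of_nonneg (by positivity), inv_mul_lt_iff₀ hpos]
    linarith
  have hmem : ∀ t : ℝ, |t| = 1 / 2 →
      p + t • v ∈ {y : E | y ∈ Metric.ball 0 1 ∧ dist x y < c * ‖y‖} := by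
    intro t ht
    have htv : ‖t • v‖ = 1 / 2 := by rw [norm_smul, hv, Real.norm_eq_abs, ht, mul_one]
    have hort : ⟪p, t • v⟫ = 0 := by simp [hp, inner_smul_left, inner_smul_right, hxv]
    refine ⟨?_, ?_⟩
    · rw [mem_ball_zero_iff]
      linarith [norm_add_le p (t • v)]
    · rw [dist_eq_norm, ← sub_sub, hxp, ← sq_lt_sq₀ (norm_nonneg _) (by positivity), mul_pow,
        norm_sub_sq_real, norm_add_sq_real, inner_smul_left, hort, norm_smul, htv, mul_pow,
        Real.norm_eq_abs, sq_abs, conj_trivial]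
      nlinarith
  intro h
  have hmid := h (hmem (1 / 2) (by norm_num)) (hmem (-(1 / 2)) (by norm_num))
    (a := 1 / 2) (b := 1 / 2) (by norm_num) (by norm_num) (by norm_num)
  have heq : (1 / 2 : ℝ) • (p + (1 / 2 : ℝ) • v) + (1 / 2 : ℝ) • (p + (-(1 / 2) : ℝ) • v) = p := by
    module
  rw [heq] at hmid
  have hlt := hmid.2
  rw [dist_eq_norm, hxp, norm_smul, Real.norm_of_nonneg (by linarith)] at hlt
  exact lt_irrefl _ hlt

/-- In dimension at least two every vector has a unit vector orthogonal to it. -/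
theorem exists_norm_eq_one_inner_eq_zero_s17 (hE : 1 < Module.finrank ℝ E) (x : E) :
    ∃ v : E, ‖v‖ = 1 ∧ ⟪x, v⟫ = 0 := by
  have : FiniteDimensional ℝ E := Module.finite_of_finrank_pos (by lia)
  have hne : (ℝ ∙ x)ᗮ ≠ ⊥ := by
    intro hbot
    rw [Submodule.orthogonal_eq_bot_iff] at hbot
    have hle := finrank_span_le_card (R := ℝ) ({x} : Set E)
    rw [hbot, finrank_top, Set.toFinset_singleton, Finset.card_singleton] at hle
    lia
  obtain ⟨w, hw, hw0⟩ := Submodule.exists_mem_ne_zero_of_ne_bot hne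
  rw [Submodule.mem_orthogonal_singleton_iff_inner_right] at hw
  refine ⟨‖w‖⁻¹ • w, norm_smul_inv_norm hw0, ?_⟩
  rw [inner_smul_right, hw, mul_zero]

end Apollonius


/-- Let `x ∈ 𝔹ⁿ \ {0}` (`n ≥ 2`) and `r > 0`. The set
`A = {y ∈ 𝔹ⁿ : |x−y| < (eʳ−1)(1−|x|)|y|}` is convex if `r ≤ log (1 + 1/(1−|x|))`
and is not convex if `r > log (1 + 1/(1−|x|))`. -/
theorem set_A_convex_iff
    (n : ℕ) (hn : 2 ≤ n) (x : EuclideanSpace ℝ (Fin n))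
    (hx : x ∈ Metric.ball (0 : EuclideanSpace ℝ (Fin n)) 1) (hx0 : x ≠ 0)
    (r : ℝ) (hr : 0 < r) :
    (r ≤ Real.log (1 + 1 / (1 - ‖x‖)) →
      Convex ℝ {y : EuclideanSpace ℝ (Fin n) |
        y ∈ Metric.ball (0 : EuclideanSpace ℝ (Fin n)) 1 ∧
        dist x y < (Real.exp r - 1) * (1 - ‖x‖) * ‖y‖}) ∧
    (Real.log (1 + 1 / (1 - ‖x‖)) < r →
      ¬ Convex ℝ {y : EuclideanSpace ℝ (Fin n) |
        y ∈ Metric.ball (0 : EuclideanSpace ℝ (Fin n)) 1 ∧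
        dist x y < (Real.exp r - 1) * (1 - ‖x‖) * ‖y‖}) := by
  have hd : 0 < 1 - ‖x‖ := sub_pos.2 (mem_ball_zero_iff.1 hx)
  have hexp : 0 < Real.exp r - 1 := sub_pos.2 (Real.one_lt_exp_iff.2 hr)
  constructor
  · intro h
    rw [Real.le_log_iff_exp_le (by positivity), ← sub_le_iff_le_add', le_div_iff₀ hd] at h
    exact (convex_ball _ _).inter (convex_setOf_dist_lt_mul_norm x (by positivity) h)
  · intro h
    rw [Real.log_lt_iff_lt_exp (by positivity), ← lt_sub_iff_add_lt', div_lt_iff₀ hd] at h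
    obtain ⟨v, hv, hxv⟩ := exists_norm_eq_one_inner_eq_zero_s17 (by rwa [finrank_euclideanSpace_fin]) x
    exact not_convex_setOf_dist_lt_mul_norm (mem_ball_zero_iff.1 hx) hv hxv h
end

section
/- Let n ≥ 2, let 𝔹^n be the open Euclidean unit ball in ℝ^n, let x ∈ 𝔹^n with x ≠ 0, and let r > 0. Then the set B = { y ∈ 𝔹^n : |x−y| < (e^r − 1)|x|(1−|y|) } is strictly convex, i.e. B is convex and for any two distinct points u, v in the closure of B the open segment between u and v lies in the interior of B. -/
/-- Two distinct points on a common ray from `0` and on a common ray from `x ≠ 0` are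
multiples of `x`, lying on the same side of `0` and on the same side of `x`. -/
theorem SameRay.exists_smul_of_sub {E : Type*} [AddCommGroup E] [Module ℝ E] {x u v : E}
    (hx0 : x ≠ 0) (huv : u ≠ v) (h₁ : SameRay ℝ u v) (h₂ : SameRay ℝ (x - u) (x - v)) :
    ∃ α β : ℝ, u = α • x ∧ v = β • x ∧ 0 ≤ α * β ∧ 0 ≤ (1 - α) * (1 - β) := by
  obtain ⟨e, a, b, ha, hb, -, rfl, rfl⟩ := h₁.exists_eq_smul
  obtain ⟨d, p, q, hp, hq, -, hpd, hqd⟩ := h₂.exists_eq_smul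
  have hd : (q - p) • d = (a - b) • e := by
    rw [sub_smul, ← hpd, ← hqd, sub_smul]
    abel
  have hab : a - b ≠ 0 := fun h => huv (by rw [sub_eq_zero.mp h])
  have he : e ≠ 0 := fun h => huv (by simp [h])
  have hqp : q - p ≠ 0 := by
    intro h
    rw [h, zero_smul] at hd
    exact (smul_ne_zero hab he) hd.symm
  obtain ⟨s, rfl⟩ : ∃ s : ℝ, d = s • e :=
    ⟨(q - p)⁻¹ * (a - b), by rw [mul_smul, ← hd, inv_smul_smul₀ hqp]⟩
  obtain ⟨k, rfl⟩ : ∃ k : ℝ, x = k • e :=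
    ⟨a + p * s, by rw [add_smul, mul_smul, ← hpd]; abel⟩
  have hk : k ≠ 0 := fun h => hx0 (by rw [h, zero_smul])
  have hks : ∀ {t w : ℝ}, k • e - t • e = w • s • e → 1 - t / k = w * s / k := by
    intro t w h
    rw [← sub_smul, smul_smul] at h
    rw [← smul_left_injective ℝ he h]
    field_simp
  refine ⟨a / k, b / k, ?_, ?_, ?_, ?_⟩
  · rw [smul_smul, div_mul_cancel₀ _ hk]
  · rw [smul_smul, div_mul_cancel₀ _ hk]
  · rw [div_mul_div_comm]
    exact div_nonneg (mul_nonneg ha hb) (mul_self_nonneg k)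
  · rw [hks hpd, hks hqd]
    have : p * s / k * (q * s / k) = p * q * (s / k) ^ 2 := by ring
    rw [this]
    positivity

/-- On each of the three intervals cut out by `0` and `1`, the function
`t ↦ (|1 - t| + c * |t|) * m` takes the value `c` at most once. -/
theorem eq_of_abs_one_sub_add_mul_abs_eq {m c α β : ℝ} (hm0 : 0 < m) (hm1 : m < 1) (hc : 0 < c)
    (h0 : 0 ≤ α * β) (h1 : 0 ≤ (1 - α) * (1 - β))
    (hα : |1 - α| * m + c * (|α| * m) = c) (hβ : |1 - β| * m + c * (|β| * m) = c) : α = β := by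
  have hsum : |1 - α| + c * |α| = |1 - β| + c * |β| :=
    mul_right_cancel₀ hm0.ne' (by linarith)
  rcases mul_nonneg_iff.mp h0 with ⟨ha, hb⟩ | ⟨ha, hb⟩
  · rw [abs_of_nonneg ha] at hα hsum
    rw [abs_of_nonneg hb] at hβ hsum
    rcases mul_nonneg_iff.mp h1 with ⟨ha', hb'⟩ | ⟨ha', hb'⟩
    · rw [abs_of_nonneg ha'] at hα hsum
      rw [abs_of_nonneg hb'] at hsum
      have hprod : (c - 1) * (α - β) = 0 := by linarith
      rcases mul_eq_zero.mp hprod with h | h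
      · obtain rfl : c = 1 := by linarith
        linarith
      · linarith
    · rw [abs_of_nonpos ha', abs_of_nonpos hb'] at hsum
      exact mul_left_cancel₀ (by positivity : 1 + c ≠ 0) (by linarith)
  · rw [abs_of_nonpos ha, abs_of_nonpos hb, abs_of_nonneg (by linarith : 0 ≤ 1 - α),
      abs_of_nonneg (by linarith : 0 ≤ 1 - β)] at hsum
    exact mul_left_cancel₀ (by positivity : 1 + c ≠ 0) (by linarith)

/-- The sublevel set `{y | ‖x - y‖ + c * ‖y‖ ≤ c}` is strictly convex, with strict inequality
on open segments, when `0 < ‖x‖ < 1`. -/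
theorem norm_sub_add_mul_norm_lt_of_mem_openSegment {E : Type*} [NormedAddCommGroup E]
    [NormedSpace ℝ E] [StrictConvexSpace ℝ E] {x u v w : E} {c : ℝ} (hx0 : x ≠ 0)
    (hx1 : ‖x‖ < 1) (hc : 0 < c) (huv : u ≠ v) (hu : ‖x - u‖ + c * ‖u‖ ≤ c)
    (hv : ‖x - v‖ + c * ‖v‖ ≤ c) (hw : w ∈ openSegment ℝ u v) : ‖x - w‖ + c * ‖w‖ < c := by
  obtain ⟨a, b, ha, hb, hab, rfl⟩ := hw
  have hsplit : x - (a • u + b • v) = a • (x - u) + b • (x - v) := by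
    nth_rewrite 1 [← one_smul ℝ x]
    rw [← hab]
    module
  have hna : ∀ z : E, ‖a • z‖ = a * ‖z‖ := fun z => norm_smul_of_nonneg ha.le z
  have hnb : ∀ z : E, ‖b • z‖ = b * ‖z‖ := fun z => norm_smul_of_nonneg hb.le z
  have h₁ := norm_add_le (a • u) (b • v)
  have h₂ := norm_add_le (a • (x - u)) (b • (x - v))
  have hau := mul_le_mul_of_nonneg_left hu ha.le
  have hbv := mul_le_mul_of_nonneg_left hv hb.le
  have hsum : a * c + b * c = c := by rw [← add_mul, hab, one_mul]
  have hc₁ := mul_le_mul_of_nonneg_left h₁ hc.le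
  rw [hsplit]
  by_contra! hcon
  simp only [hna, hnb] at h₁ h₂ hc₁
  have hray : ∀ {y z : E}, SameRay ℝ (a • y) (b • z) → SameRay ℝ y z := fun {y z} h => by
    simpa only [inv_smul_smul₀ ha.ne', inv_smul_smul₀ hb.ne'] using
      (h.pos_smul_left (inv_pos.mpr ha)).pos_smul_right (inv_pos.mpr hb)
  have hr₁ : SameRay ℝ u v := by
    refine hray (sameRay_iff_norm_add.mpr ?_)
    rw [hna, hnb]
    exact mul_left_cancel₀ hc.ne' (by linarith)
  have hr₂ : SameRay ℝ (x - u) (x - v) := by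
    refine hray (sameRay_iff_norm_add.mpr ?_)
    rw [hna, hnb]
    linarith
  have hu' : ‖x - u‖ + c * ‖u‖ = c := mul_left_cancel₀ ha.ne' (by linarith)
  have hv' : ‖x - v‖ + c * ‖v‖ = c := mul_left_cancel₀ hb.ne' (by linarith)
  obtain ⟨α, β, rfl, rfl, h0, h1⟩ := SameRay.exists_smul_of_sub hx0 huv hr₁ hr₂
  have hnorm : ∀ t : ℝ, ‖x - t • x‖ = |1 - t| * ‖x‖ := fun t => by
    rw [← Real.norm_eq_abs, ← norm_smul, sub_smul, one_smul]
  rw [hnorm, norm_smul, Real.norm_eq_abs] at hu' hv'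
  exact huv (by
    rw [eq_of_abs_one_sub_add_mul_abs_eq (norm_pos_iff.mpr hx0) hx1 hc h0 h1 hu' hv'])

/-- Let `x ∈ 𝔹ⁿ \ {0}` (`n ≥ 2`) and `r > 0`. The set
`B = {y ∈ 𝔹ⁿ : |x−y| < (eʳ−1)|x|(1−|y|)}` is strictly convex: it is convex, and
the open segment between any two distinct points of its closure lies in its
interior. -/
theorem set_B_strictly_convex
    (n : ℕ) (hn : 2 ≤ n) (x : EuclideanSpace ℝ (Fin n))
    (hx : x ∈ Metric.ball (0 : EuclideanSpace ℝ (Fin n)) 1) (hx0 : x ≠ 0)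
    (r : ℝ) (hr : 0 < r) :
    Convex ℝ {y : EuclideanSpace ℝ (Fin n) |
      y ∈ Metric.ball (0 : EuclideanSpace ℝ (Fin n)) 1 ∧
      dist x y < (Real.exp r - 1) * ‖x‖ * (1 - ‖y‖)} ∧
    ∀ u ∈ closure {y : EuclideanSpace ℝ (Fin n) |
        y ∈ Metric.ball (0 : EuclideanSpace ℝ (Fin n)) 1 ∧
        dist x y < (Real.exp r - 1) * ‖x‖ * (1 - ‖y‖)},
      ∀ v ∈ closure {y : EuclideanSpace ℝ (Fin n) |
        y ∈ Metric.ball (0 : EuclideanSpace ℝ (Fin n)) 1 ∧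
        dist x y < (Real.exp r - 1) * ‖x‖ * (1 - ‖y‖)},
      u ≠ v →
        openSegment ℝ u v ⊆
          interior {y : EuclideanSpace ℝ (Fin n) |
            y ∈ Metric.ball (0 : EuclideanSpace ℝ (Fin n)) 1 ∧
            dist x y < (Real.exp r - 1) * ‖x‖ * (1 - ‖y‖)} := by
  rw [mem_ball_zero_iff] at hx
  obtain ⟨c, hcdef⟩ : ∃ c, c = (Real.exp r - 1) * ‖x‖ := ⟨_, rfl⟩
  have hc : 0 < c := by
    rw [hcdef]
    exact mul_pos (sub_pos.mpr (Real.one_lt_exp_iff.mpr hr)) (norm_pos_iff.mpr hx0)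
  rw [← hcdef]
  have hset : {y : EuclideanSpace ℝ (Fin n) |
      y ∈ Metric.ball (0 : EuclideanSpace ℝ (Fin n)) 1 ∧ dist x y < c * (1 - ‖y‖)} =
      {y | ‖x - y‖ + c * ‖y‖ < c} := by
    ext y
    simp only [Set.mem_ofPred_eq, mem_ball_zero_iff, dist_eq_norm]
    refine ⟨fun h => by linarith [h.2], fun h => ⟨?_, by linarith⟩⟩
    exact (mul_lt_iff_lt_one_right hc).mp (by linarith [norm_nonneg (x - y)])
  rw [hset]
  have hcont : Continuous fun y : EuclideanSpace ℝ (Fin n) => ‖x - y‖ + c * ‖y‖ := by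
    fun_prop
  have hopen : IsOpen {y : EuclideanSpace ℝ (Fin n) | ‖x - y‖ + c * ‖y‖ < c} :=
    isOpen_lt hcont continuous_const
  have hclosure : closure {y : EuclideanSpace ℝ (Fin n) | ‖x - y‖ + c * ‖y‖ < c} ⊆
      {y | ‖x - y‖ + c * ‖y‖ ≤ c} :=
    closure_lt_subset_le hcont continuous_const
  refine ⟨convex_iff_openSegment_subset.mpr fun u hu v hv w hw => ?_,
    fun u hu v hv huv w hw => ?_⟩
  · rcases eq_or_ne u v with rfl | huv
    · rw [openSegment_same] at hw
      exact hw ▸ hu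
    · exact norm_sub_add_mul_norm_lt_of_mem_openSegment hx0 hx hc huv (le_of_lt hu)
        (le_of_lt hv) hw
  · rw [hopen.interior_eq]
    exact norm_sub_add_mul_norm_lt_of_mem_openSegment hx0 hx hc huv (hclosure hu)
      (hclosure hv) hw
end
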